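/- arXiv:2108.11132 — 3 statements merged into one kernel-verified Lean document; each statement's English description precedes it below -/
import Mathlib

section
/- Let P ⊂ ℝ^d be a lattice polytope that is not a zonotope. Then there exists c ∈ ℚ^d all of whose coordinates have odd denominators such that L_{(P,c)} ≠ L_{(P,2c)}, i.e., there is a positive integer t with #((c + tP) ∩ ℤ^d) ≠ #((2c + tP) ∩ ℤ^d). -/
open Pointwise MeasureTheory
open scoped RealInnerProductSpace

noncomputable section

/-- Cast an integer vector to a real vector. -/
def castVec {d : ℕ} (x : Fin d → ℤ) : Fin d → ℝ := fun i => (x i : ℝ)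

/-- Cast a rational vector to a real vector. -/
def ratVec {d : ℕ} (c : Fin d → ℚ) : Fin d → ℝ := fun i => (c i : ℝ)

/-- `den(c)`: the lcm of the denominators of the coordinates of a rational vector. -/
def denv {d : ℕ} (c : Fin d → ℚ) : ℕ := Finset.univ.lcm fun i => (c i).den

/-- The number of lattice points in a subset of `ℝ^d`. -/
def latCount {d : ℕ} (S : Set (Fin d → ℝ)) : ℕ := {x : Fin d → ℤ | castVec x ∈ S}.ncard

/-- A lattice polytope: the convex hull of a nonempty finite set of integer points. -/
def IsLatticePolytope {d : ℕ} (P : Set (Fin d → ℝ)) : Prop :=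
  ∃ V : Finset (Fin d → ℤ), V.Nonempty ∧ P = convexHull ℝ (castVec '' (V : Set (Fin d → ℤ)))

/-- The zonotope spanned by a finite set of integer vectors. -/
def zonotopeF {d : ℕ} (U : Finset (Fin d → ℤ)) : Set (Fin d → ℝ) :=
  {x | ∃ lam : (Fin d → ℤ) → ℝ, (∀ u, lam u ∈ Set.Icc (0 : ℝ) 1) ∧
    x = ∑ u ∈ U, lam u • castVec u}

/-- The zonotope spanned by integer vectors `u 0, …, u (n-1)`. -/
def zonotopeZ {d n : ℕ} (u : Fin n → Fin d → ℤ) : Set (Fin d → ℝ) :=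
  {x | ∃ lam : Fin n → ℝ, (∀ i, lam i ∈ Set.Icc (0 : ℝ) 1) ∧ x = ∑ i, lam i • castVec (u i)}

/-- The zonotope spanned by real vectors `u 0, …, u (n-1)`. -/
def zonotopeR {d n : ℕ} (u : Fin n → Fin d → ℝ) : Set (Fin d → ℝ) :=
  {x | ∃ lam : Fin n → ℝ, (∀ i, lam i ∈ Set.Icc (0 : ℝ) 1) ∧ x = ∑ i, lam i • u i}

/-- A zonotope: a translate of the Minkowski sum of finitely many segments `[0, uᵢ]`. -/
def IsZonotope {d : ℕ} (P : Set (Fin d → ℝ)) : Prop :=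
  ∃ (n : ℕ) (u : Fin n → Fin d → ℝ) (v : Fin d → ℝ), P = v +ᵥ zonotopeR u

/-- A set is centrally symmetric if it is a translate of its negation. -/
def CentrallySymmetric {d : ℕ} (P : Set (Fin d → ℝ)) : Prop :=
  ∃ v : Fin d → ℝ, P = v +ᵥ (-P)

/-- `f` is a family of constituents of `L` with respect to the period `ρ`. -/
def IsConstituents (L : ℕ → ℚ) (ρ : ℕ) (f : ℕ → Polynomial ℚ) : Prop :=
  ∀ t : ℕ, 0 < t → L t = (f (t % ρ)).eval (t : ℚ)

/-- `ρ` is a period of the quasi-polynomial `L`. -/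
def IsPeriodOf (ρ : ℕ) (L : ℕ → ℚ) : Prop := 0 < ρ ∧ ∃ f, IsConstituents L ρ f

/-- `ρ₀` is the minimal period of the quasi-polynomial `L`. -/
def IsMinimalPeriodOf (ρ₀ : ℕ) (L : ℕ → ℚ) : Prop :=
  IsPeriodOf ρ₀ L ∧ ∀ ρ : ℕ, IsPeriodOf ρ L → ρ₀ ≤ ρ

/-- GCD-property with respect to the period `ρ`: constituents with equal
`gcd(ρ, ·)` coincide. -/
def GCDProperty (L : ℕ → ℚ) (ρ : ℕ) : Prop :=
  ∀ f : ℕ → Polynomial ℚ, IsConstituents L ρ f →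
    ∀ k ℓ : ℕ, Nat.gcd ρ k = Nat.gcd ρ ℓ → f (k % ρ) = f (ℓ % ρ)

/-- Symmetry with respect to the period `ρ`: `f_k = f_{ρ-k}` for `0 ≤ k ≤ ρ`. -/
def SymmetricQP (L : ℕ → ℚ) (ρ : ℕ) : Prop :=
  ∀ f : ℕ → Polynomial ℚ, IsConstituents L ρ f →
    ∀ k : ℕ, k ≤ ρ → f (k % ρ) = f ((ρ - k) % ρ)

/-- The Ehrhart counting function `t ↦ #(t(c + P) ∩ ℤ^d)` of the translate `c + P`. -/
def ehr {d : ℕ} (P : Set (Fin d → ℝ)) (c : Fin d → ℚ) : ℕ → ℚ :=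
  fun t => (latCount ((t : ℝ) • (ratVec c +ᵥ P)) : ℚ)

/-- The dimension of a polytope: the dimension of the direction of its affine hull. -/
def polyDim {d : ℕ} (P : Set (Fin d → ℝ)) : ℕ := Module.finrank ℝ (affineSpan ℝ P).direction

/-- `r` is the relative volume of `P` (of dimension `m`): with respect to any lattice
point `v₀` of `P` and any `ℤ`-basis `b` of the lattice `aff₀(P) ∩ ℤ^d`, `r` is the
Lebesgue measure of `P` in the coordinates determined by `v₀` and `b`. -/
def IsRelVolOf {d : ℕ} (P : Set (Fin d → ℝ)) (m : ℕ) (r : ℝ) : Prop :=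
  ∀ (v₀ : Fin d → ℤ) (b : Fin m → Fin d → ℤ),
    castVec v₀ ∈ P → LinearIndependent ℤ b →
    (∀ x : Fin d → ℤ,
      castVec x ∈ (affineSpan ℝ P).direction ↔ x ∈ Submodule.span ℤ (Set.range b)) →
    r = (volume {lam : Fin m → ℝ | castVec v₀ + ∑ i, lam i • castVec (b i) ∈ P}).toReal

/-- The (real casts of the) elements of `W` are linearly independent over `ℝ`. -/
def LinIndepF {d : ℕ} (W : Finset (Fin d → ℤ)) : Prop :=
  LinearIndependent ℝ fun w : ↥W => castVec w.1

/-- Almost locally constant: locally constant outside a discrete point set. -/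
def AlmostLocallyConstant (f : ℝ → ℝ) : Prop :=
  ∃ D : Set ℝ, DiscreteTopology D ∧ IsLocallyConstant fun x : ↥(Dᶜ) => f ↑x

/-- Almost constant: constant outside a discrete point set. -/
def AlmostConstant (f : ℝ → ℝ) : Prop :=
  ∃ D : Set ℝ, DiscreteTopology D ∧ ∃ r : ℝ, ∀ x ∉ D, f x = r

/-- The face of `P` in the outer normal direction `v`. -/
def normalFace {d : ℕ} (P : Set (EuclideanSpace ℝ (Fin d)))
    (v : EuclideanSpace ℝ (Fin d)) : Set (EuclideanSpace ℝ (Fin d)) :=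
  {x | x ∈ P ∧ ∀ y ∈ P, ⟪y, v⟫ ≤ ⟪x, v⟫}

/-- `F` is a facet of the `d`-polytope `P`: an exposed face of dimension `d - 1`. -/
def IsFacetOf {d : ℕ} (F P : Set (EuclideanSpace ℝ (Fin d))) : Prop :=
  (∃ v : EuclideanSpace ℝ (Fin d), v ≠ 0 ∧ F = normalFace P v) ∧
  Module.finrank ℝ (affineSpan ℝ F).direction = d - 1

lemma castVec_dotProduct_castVec {d : ℕ} (a v : Fin d → ℤ) :
    castVec a ⬝ᵥ castVec v = ((a ⬝ᵥ v : ℤ) : ℝ) := by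
  simp [castVec, dotProduct]

lemma castVec_add {d : ℕ} (a v : Fin d → ℤ) : castVec (a + v) = castVec a + castVec v := by
  ext i; simp [castVec]

lemma castVec_smul {d : ℕ} (k : ℤ) (v : Fin d → ℤ) :
    castVec (k • v) = (k : ℝ) • castVec v := by
  ext i; simp [castVec]

/-- A cone spanned by finitely many integer vectors is cut out by finitely many homogeneous
linear inequalities with integer coefficients. -/
lemma exists_integer_inequalities_cone {n : ℕ} (S : Finset (Fin n → ℤ)) :
    ∃ A : Finset (Fin n → ℤ), ∀ x : Fin n → ℝ,
      (∃ lam : (Fin n → ℤ) → ℝ, (∀ v, 0 ≤ lam v) ∧ x = ∑ v ∈ S, lam v • castVec v) ↔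
        ∀ a ∈ A, castVec a ⬝ᵥ x ≤ 0 := by
  classical
  induction S using Finset.induction_on with
  | empty =>
    refine ⟨Finset.univ.image (fun i => Pi.single i (1 : ℤ)) ∪
      Finset.univ.image (fun i => Pi.single i (-1 : ℤ)), fun x => ⟨?_, fun h => ?_⟩⟩
    · rintro ⟨lam, -, rfl⟩
      simp
    · refine ⟨0, fun _ => le_rfl, ?_⟩
      ext i
      have hc : ∀ k : ℤ, castVec (Pi.single i k) ⬝ᵥ x = k * x i := by
        intro k
        have : castVec (Pi.single i k) = Pi.single i (k : ℝ) := by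
          ext j
          by_cases hj : j = i
          · subst hj; simp [castVec]
          · simp [castVec, hj]
        rw [this, single_dotProduct]
      have h1 := h (Pi.single i 1) (by simp)
      have h2 := h (Pi.single i (-1)) (by simp)
      rw [hc] at h1 h2
      push_cast at h1 h2
      simp
      linarith
  | insert v S hv ih =>
    obtain ⟨A, hA⟩ := ih
    have key : ∀ x : Fin n → ℝ, (∃ lam : (Fin n → ℤ) → ℝ, (∀ v, 0 ≤ lam v) ∧
        x = ∑ v ∈ insert v S, lam v • castVec v) ↔
        ∃ r : ℝ, 0 ≤ r ∧ ∀ a ∈ A, castVec a ⬝ᵥ (x - r • castVec v) ≤ 0 := by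
      intro x
      constructor
      · rintro ⟨lam, h0, rfl⟩
        refine ⟨lam v, h0 v, (hA _).1 ⟨lam, h0, ?_⟩⟩
        rw [Finset.sum_insert hv, add_sub_cancel_left]
      · rintro ⟨r, hr, h⟩
        obtain ⟨lam, h0, h1⟩ := (hA _).2 h
        refine ⟨Function.update lam v r, fun u => ?_, ?_⟩
        · by_cases hu : u = v
          · subst hu; simpa using hr
          · simpa [hu] using h0 u
        · rw [Finset.sum_insert hv, Function.update_self]
          rw [Finset.sum_congr rfl (g := fun u => lam u • castVec u)]
          · rw [← h1]; abel
          · intro u hu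
            rw [Function.update_of_ne]
            rintro rfl
            exact hv hu
    refine ⟨A.filter (fun a => a ⬝ᵥ v ≤ 0) ∪
      ((A.filter (fun a => 0 < a ⬝ᵥ v)) ×ˢ (A.filter (fun a => a ⬝ᵥ v < 0))).image
        (fun p => (-(p.2 ⬝ᵥ v)) • p.1 + (p.1 ⬝ᵥ v) • p.2), fun x => ?_⟩
    rw [key]
    simp only [dotProduct_sub, dotProduct_smul, castVec_dotProduct_castVec, smul_eq_mul]
    constructor
    · rintro ⟨r, hr, h⟩ a ha
      simp only [Finset.mem_union, Finset.mem_filter, Finset.mem_image, Finset.mem_product] at ha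
      rcases ha with ⟨ha, hav⟩ | ⟨⟨p, q⟩, ⟨⟨hp, hpv⟩, hq, hqv⟩, rfl⟩
      · have h1 := h a ha
        have : ((a ⬝ᵥ v : ℤ) : ℝ) ≤ 0 := by exact_mod_cast hav
        nlinarith
      · have h1 := h p hp
        have h2 := h q hq
        have h3 : (0 : ℝ) < ((p ⬝ᵥ v : ℤ) : ℝ) := by exact_mod_cast hpv
        have h4 : ((q ⬝ᵥ v : ℤ) : ℝ) < 0 := by exact_mod_cast hqv
        simp only [castVec_add, castVec_smul, add_dotProduct, smul_dotProduct, smul_eq_mul]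
        push_cast
        nlinarith
    · intro h
      have hneg : ∀ a ∈ A, a ⬝ᵥ v ≤ 0 → castVec a ⬝ᵥ x ≤ 0 := fun a ha hav =>
        h a (by simp [ha, hav])
      have hpair : ∀ p ∈ A, ∀ q ∈ A, 0 < p ⬝ᵥ v → q ⬝ᵥ v < 0 →
          (-(q ⬝ᵥ v : ℤ) : ℝ) * (castVec p ⬝ᵥ x) + (p ⬝ᵥ v : ℤ) * (castVec q ⬝ᵥ x) ≤ 0 := by
        intro p hp q hq hpv hqv
        have := h ((-(q ⬝ᵥ v)) • p + (p ⬝ᵥ v) • q) (by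
          refine Finset.mem_union_right _ (Finset.mem_image.2 ⟨(p, q), ?_, rfl⟩)
          simp [hp, hq, hpv, hqv])
        simpa only [castVec_add, castVec_smul, add_dotProduct, smul_dotProduct, smul_eq_mul,
          Int.cast_neg] using this
      set r : ℝ := (insert 0 ((A.filter (fun a => 0 < a ⬝ᵥ v)).image
        (fun a => castVec a ⬝ᵥ x / (a ⬝ᵥ v : ℤ)))).sup' (Finset.insert_nonempty _ _) id with hr
      refine ⟨r, Finset.le_sup' id (Finset.mem_insert_self _ _), fun a ha => ?_⟩
      rcases lt_trichotomy (a ⬝ᵥ v) 0 with hav | hav | hav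
      · have hav' : ((a ⬝ᵥ v : ℤ) : ℝ) < 0 := by exact_mod_cast hav
        have hle : r ≤ castVec a ⬝ᵥ x / (a ⬝ᵥ v : ℤ) := by
          refine Finset.sup'_le _ _ fun t ht => ?_
          rcases Finset.mem_insert.1 ht with rfl | ht
          · exact div_nonneg_of_nonpos (hneg a ha hav.le) hav'.le
          · obtain ⟨p, hp, rfl⟩ := Finset.mem_image.1 ht
            obtain ⟨hp, hpv⟩ := Finset.mem_filter.1 hp
            have hpv' : (0 : ℝ) < ((p ⬝ᵥ v : ℤ) : ℝ) := by exact_mod_cast hpv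
            have := hpair p hp a ha hpv hav
            simp only [id]
            rw [le_div_iff_of_neg hav', ← sub_nonneg]
            have h5 : castVec p ⬝ᵥ x / ↑(p ⬝ᵥ v) * ↑(a ⬝ᵥ v) - castVec a ⬝ᵥ x =
              -((-(a ⬝ᵥ v : ℤ) : ℝ) * (castVec p ⬝ᵥ x) + (p ⬝ᵥ v : ℤ) * (castVec a ⬝ᵥ x)) /
                (p ⬝ᵥ v : ℤ) := by
              field_simp
              ring
            rw [h5]
            exact div_nonneg (by linarith) hpv'.le
        rw [le_div_iff_of_neg hav'] at hle
        linarith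
      · simp only [hav, Int.cast_zero, mul_zero, sub_zero]
        exact hneg a ha hav.le
      · have hav' : (0 : ℝ) < ((a ⬝ᵥ v : ℤ) : ℝ) := by exact_mod_cast hav
        have hmem : castVec a ⬝ᵥ x / (a ⬝ᵥ v : ℤ) ∈ insert 0
            ((A.filter (fun a => 0 < a ⬝ᵥ v)).image (fun a => castVec a ⬝ᵥ x / (a ⬝ᵥ v : ℤ))) :=
          Finset.mem_insert_of_mem (Finset.mem_image.2 ⟨a, Finset.mem_filter.2 ⟨ha, hav⟩, rfl⟩)
        have hle : castVec a ⬝ᵥ x / (a ⬝ᵥ v : ℤ) ≤ r := Finset.le_sup' id hmem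
        rw [div_le_iff₀ hav'] at hle
        linarith

/-- A lattice polytope is cut out by finitely many linear inequalities with integer
coefficients. -/
lemma exists_integer_inequalities_convexHull {d : ℕ} (V : Finset (Fin d → ℤ)) :
    ∃ A : Finset ((Fin d → ℤ) × ℤ), ∀ x : Fin d → ℝ,
      x ∈ convexHull ℝ (castVec '' (V : Set (Fin d → ℤ))) ↔
        ∀ q ∈ A, castVec q.1 ⬝ᵥ x ≤ q.2 := by
  classical
  obtain ⟨A, hA⟩ := exists_integer_inequalities_cone
    (V.image (fun v => (Fin.cons 1 v : Fin (d + 1) → ℤ)))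
  refine ⟨A.image fun a => (Fin.tail a, -a 0), fun x => ?_⟩
  have hcons : ∀ v : Fin d → ℤ, castVec (Fin.cons 1 v : Fin (d + 1) → ℤ) =
      Fin.cons 1 (castVec v) := by
    intro v
    ext i
    refine Fin.cases ?_ (fun j => ?_) i <;> simp [castVec]
  have hinj : Function.Injective (fun v => (Fin.cons 1 v : Fin (d + 1) → ℤ)) :=
    fun u v h => Fin.cons_right_injective (α := fun _ => ℤ) 1 h
  have hcinj : Function.Injective (castVec : (Fin d → ℤ) → Fin d → ℝ) := by
    intro u v h
    ext i
    have := congrFun h i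
    simpa [castVec] using this
  have h1 : x ∈ convexHull ℝ (castVec '' (V : Set (Fin d → ℤ))) ↔
      ∃ lam : (Fin (d + 1) → ℤ) → ℝ, (∀ v, 0 ≤ lam v) ∧ (Fin.cons 1 x : Fin (d + 1) → ℝ) =
        ∑ v ∈ V.image (fun v => (Fin.cons 1 v : Fin (d + 1) → ℤ)), lam v • castVec v := by
    rw [← Finset.coe_image, Finset.convexHull_eq]
    constructor
    · rintro ⟨w, hw0, hw1, hw2⟩
      rw [Finset.sum_image hcinj.injOn] at hw1
      rw [Finset.centerMass_eq_of_sum_1 _ _ (by rwa [Finset.sum_image hcinj.injOn]),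
        Finset.sum_image hcinj.injOn] at hw2
      refine ⟨fun u => if castVec (Fin.tail u) ∈ V.image castVec then
        w (castVec (Fin.tail u)) else 0, fun u => ?_, ?_⟩
      · dsimp only
        split_ifs with h
        · exact hw0 _ h
        · exact le_rfl
      · rw [Finset.sum_image hinj.injOn]
        have : ∀ v ∈ V, (if castVec (Fin.tail (Fin.cons 1 v : Fin (d + 1) → ℤ)) ∈ V.image castVec then
            w (castVec (Fin.tail (Fin.cons 1 v : Fin (d + 1) → ℤ))) else 0) •
            castVec (Fin.cons 1 v : Fin (d + 1) → ℤ) =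
            w (castVec v) • (Fin.cons 1 (castVec v) : Fin (d + 1) → ℝ) := by
          intro v hv
          rw [Fin.tail_cons, if_pos (Finset.mem_image_of_mem _ hv), hcons]
        rw [Finset.sum_congr rfl this]
        ext i
        refine Fin.cases ?_ (fun j => ?_) i
        · simp [hw1]
        · simp [← hw2]
    · rintro ⟨lam, h0, h1⟩
      rw [Finset.sum_image hinj.injOn] at h1
      simp only [hcons] at h1
      have hs : ∑ v ∈ V, lam (Fin.cons 1 v : Fin (d + 1) → ℤ) = 1 := by
        have := congrFun h1 0
        simpa using this.symm
      have hx : x = ∑ v ∈ V, lam (Fin.cons 1 v : Fin (d + 1) → ℤ) • castVec v := by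
        ext j
        have := congrFun h1 j.succ
        simpa using this
      have hli : ∀ v : Fin d → ℤ, Function.invFun castVec (castVec v) = v :=
        Function.leftInverse_invFun hcinj
      refine ⟨fun y => lam (Fin.cons 1 (Function.invFun castVec y) : Fin (d + 1) → ℤ),
        fun _ _ => h0 _, ?_, ?_⟩
      · rw [Finset.sum_image hcinj.injOn]
        simpa only [hli] using hs
      · rw [Finset.centerMass_eq_of_sum_1, Finset.sum_image hcinj.injOn]
        · simpa only [hli, id] using hx.symm
        · rw [Finset.sum_image hcinj.injOn]
          simpa only [hli] using hs
  rw [h1, hA]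
  simp only [Finset.forall_mem_image]
  refine forall₂_congr fun a _ => ?_
  have : castVec a ⬝ᵥ (Fin.cons 1 x : Fin (d + 1) → ℝ) = a 0 + castVec (Fin.tail a) ⬝ᵥ x := by
    simp [dotProduct, Fin.sum_univ_succ, castVec, Fin.tail]
  rw [this]
  push_cast
  constructor <;> intro h <;> linarith

open Classical in
/-- The Euler characteristic on the line: a vanishing combination of indicator functions of
compact intervals has vanishing total weight of the nonempty ones. -/
lemma sum_nonempty_eq_zero_of_sum_indicator_eq_zero_real {ι : Type*} (s : Finset ι) (α : ι → ℝ)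
    (I : ι → Set ℝ) (hI : ∀ i ∈ s, IsCompact (I i)) (hconv : ∀ i ∈ s, Convex ℝ (I i))
    (h : ∀ x, ∑ i ∈ s, (if x ∈ I i then α i else 0) = 0) :
    ∑ i ∈ s, (if (I i).Nonempty then α i else 0) = 0 := by
  have key : ∀ b : ℝ, ∑ i ∈ s, (if b ∈ I i ∧ sSup (I i) = b then α i else 0) = 0 := by
    intro b
    have hev : ∀ᶠ x in nhdsWithin b (Set.Ioi b), ∀ i ∈ s, (x ∈ I i ↔ b ∈ I i ∧ sSup (I i) ≠ b) := by
      rw [Filter.eventually_all_finset]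
      intro i hi
      by_cases hb : b ∈ I i
      · have hbdd := (hI i hi).bddAbove
        have hm := (hI i hi).sSup_mem ⟨b, hb⟩
        rcases (le_csSup hbdd hb).eq_or_lt with hbm | hbm
        · filter_upwards [self_mem_nhdsWithin] with x hx
          refine iff_of_false (fun hxI => ?_) (fun h => h.2 hbm.symm)
          have := le_csSup hbdd hxI
          rw [← hbm] at this
          exact absurd this (not_le.2 hx)
        · filter_upwards [Ioo_mem_nhdsGT hbm] with x hx
          exact iff_of_true ((hconv i hi).ordConnected.out hb hm ⟨hx.1.le, hx.2.le⟩) ⟨hb, hbm.ne'⟩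
      · have : (I i)ᶜ ∈ nhds b := (hI i hi).isClosed.isOpen_compl.mem_nhds hb
        filter_upwards [mem_nhdsWithin_of_mem_nhds this] with x hx
        exact iff_of_false hx (fun h => hb h.1)
    obtain ⟨x, hx⟩ := hev.exists
    have h1 := h b
    have h2 := h x
    calc ∑ i ∈ s, (if b ∈ I i ∧ sSup (I i) = b then α i else 0)
        = ∑ i ∈ s, ((if b ∈ I i then α i else 0) - (if x ∈ I i then α i else 0)) := by
          refine Finset.sum_congr rfl fun i hi => ?_
          rw [if_congr (hx i hi) rfl rfl]
          by_cases hb : b ∈ I i <;> by_cases hm : sSup (I i) = b <;> simp [hb, hm]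
      _ = 0 := by rw [Finset.sum_sub_distrib, h1, h2, sub_zero]
  rw [← Finset.sum_fiberwise_of_maps_to (g := fun i => sSup (I i))
    (t := s.image fun i => sSup (I i)) (fun i hi => Finset.mem_image_of_mem _ hi)]
  refine Finset.sum_eq_zero fun b _ => ?_
  rw [Finset.sum_filter]
  refine (Finset.sum_congr rfl fun i hi => ?_).trans (key b)
  by_cases hm : sSup (I i) = b
  · have : (I i).Nonempty ↔ b ∈ I i :=
      ⟨fun hn => hm ▸ (hI i hi).sSup_mem hn, fun hb => ⟨b, hb⟩⟩
    simp [hm, this]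
  · simp [hm]

open Classical in
/-- The Euler characteristic: a vanishing combination of indicator functions of compact convex
sets has vanishing total weight of the nonempty ones. -/
lemma sum_nonempty_eq_zero_of_sum_indicator_eq_zero {ι : Type*} (s : Finset ι) (α : ι → ℝ) :
    ∀ {d : ℕ} (C : ι → Set (Fin d → ℝ)), (∀ i ∈ s, IsCompact (C i)) →
      (∀ i ∈ s, Convex ℝ (C i)) → (∀ x, ∑ i ∈ s, (if x ∈ C i then α i else 0) = 0) →
      ∑ i ∈ s, (if (C i).Nonempty then α i else 0) = 0
  | 0, C, _, _, h => by
    refine (Finset.sum_congr rfl fun i _ => ?_).trans (h 0)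
    have : (C i).Nonempty ↔ (0 : Fin 0 → ℝ) ∈ C i :=
      ⟨fun ⟨x, hx⟩ => by rwa [Subsingleton.elim 0 x], fun hx => ⟨_, hx⟩⟩
    exact if_congr this rfl rfl
  | d + 1, C, hC, hconv, h => by
    have hslice : ∀ t : ℝ, ∑ i ∈ s,
        (if ({y : Fin d → ℝ | (Fin.cons t y : Fin (d + 1) → ℝ) ∈ C i}).Nonempty
          then α i else 0) = 0 := by
      intro t
      refine sum_nonempty_eq_zero_of_sum_indicator_eq_zero s α _ (fun i hi => ?_)
        (fun i hi => ?_) (fun y => h _)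
      · have : {y : Fin d → ℝ | (Fin.cons t y : Fin (d + 1) → ℝ) ∈ C i} =
            Fin.tail '' (C i ∩ {x | x 0 = t}) := by
          ext y
          constructor
          · intro hy
            exact ⟨_, ⟨hy, by simp⟩, by simp⟩
          · rintro ⟨x, ⟨hx, rfl⟩, rfl⟩
            simpa using hx
        rw [this]
        refine ((hC i hi).inter_right (isClosed_eq (continuous_apply 0) continuous_const)).image ?_
        exact continuous_pi fun j => continuous_apply j.succ
      · intro y hy z hz a b ha hb hab
        have := hconv i hi hy hz ha hb hab
        have he : a • (Fin.cons t y : Fin (d + 1) → ℝ) + b • (Fin.cons t z : Fin (d + 1) → ℝ) =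
            Fin.cons t (a • y + b • z) := by
          ext j
          refine Fin.cases ?_ (fun j => ?_) j
          · simp [← add_mul, hab]
          · simp
        rwa [he] at this
    have hproj : ∀ (i : ι) (t : ℝ), ({y : Fin d → ℝ | (Fin.cons t y : Fin (d + 1) → ℝ) ∈ C i}).Nonempty ↔
        t ∈ (fun x : Fin (d + 1) → ℝ => x 0) '' C i := by
      intro i t
      constructor
      · rintro ⟨y, hy⟩
        exact ⟨_, hy, by simp⟩
      · rintro ⟨x, hx, rfl⟩
        exact ⟨Fin.tail x, by simpa using hx⟩
    simp only [hproj] at hslice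
    have := sum_nonempty_eq_zero_of_sum_indicator_eq_zero_real s α _
      (fun i hi => (hC i hi).image (continuous_apply 0))
      (fun i hi => (hconv i hi).linear_image (LinearMap.proj 0)) hslice
    simpa only [Set.image_nonempty] using this

/-- Every function on finite sets is a sum over subsets. -/
lemma exists_eq_sum_powerset {α : Type*} (κ : Finset α → ℝ) :
    ∃ β : Finset α → ℝ, ∀ Z, κ Z = ∑ S ∈ Z.powerset, β S := by
  classical
  refine ⟨Finset.strongInduction
    (fun Z ih => κ Z - ∑ S ∈ Z.ssubsets.attach, ih S.1 (Finset.mem_ssubsets.1 S.2)), fun Z => ?_⟩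
  rw [← Finset.sum_erase_add _ _ (Finset.mem_powerset_self Z)]
  rw [Finset.strongInduction_eq _ Z]
  rw [Finset.sum_attach Z.ssubsets]
  exact (add_sub_cancel _ _).symm

/-- A real vector can be replaced by an integer vector on which finitely many integer linear forms
take the same signs. -/
lemma exists_integer_same_signs {d : ℕ} (A : Finset (Fin d → ℤ)) (w : Fin d → ℝ) :
    ∃ w' : Fin d → ℤ, ∀ a ∈ A, (castVec a ⬝ᵥ w = 0 → a ⬝ᵥ w' = 0) ∧
      (0 < castVec a ⬝ᵥ w → 0 < a ⬝ᵥ w') ∧ (castVec a ⬝ᵥ w < 0 → a ⬝ᵥ w' < 0) := by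
  classical
  let b := Module.Basis.ofVectorSpace ℚ ℝ
  let J := Finset.univ.biUnion fun i => (b.repr (w i)).support
  let W : (Module.Basis.ofVectorSpaceIndex ℚ ℝ → ℝ) → Fin d → ℝ := fun r i =>
    ∑ j ∈ J, (b.repr (w i) j : ℝ) * r j
  have hWcont : Continuous W := by fun_prop
  have hWb : W b = w := by
    ext i
    have : w i = (b.repr (w i)).sum fun j c => c • b j := by
      conv_lhs => rw [← b.linearCombination_repr (w i)]
      rfl
    conv_rhs => rw [this]
    rw [Finsupp.sum_of_support_subset (s := J) _ (Finset.subset_biUnion_of_mem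
      (fun i => (b.repr (w i)).support) (Finset.mem_univ i)) _ (by simp)]
    simp [W, Rat.smul_def]
  have hzero : ∀ (a : Fin d → ℤ) r, castVec a ⬝ᵥ w = 0 → castVec a ⬝ᵥ W r = 0 := by
    intro a r h
    have h2 : ∀ j, ∑ i, (a i : ℝ) * (b.repr (w i) j : ℝ) = 0 := by
      intro j
      have h3 : b.repr (∑ i, (a i : ℚ) • w i) j = 0 := by
        have : ∑ i, (a i : ℚ) • w i = 0 := by
          rw [← h]
          simp [dotProduct, castVec, Rat.smul_def]
        rw [this]; simp
      rw [map_sum, Finsupp.finsetSum_apply] at h3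
      simp only [map_smul, Finsupp.smul_apply, smul_eq_mul] at h3
      exact_mod_cast h3
    simp only [dotProduct, castVec, W, Finset.mul_sum]
    rw [Finset.sum_comm]
    refine Finset.sum_eq_zero fun j _ => ?_
    rw [← zero_mul (r j), ← h2 j, Finset.sum_mul]
    exact Finset.sum_congr rfl fun i _ => by ring
  have hopen : ∀ᶠ r in nhds (b : Module.Basis.ofVectorSpaceIndex ℚ ℝ → ℝ), ∀ a ∈ A,
      (0 < castVec a ⬝ᵥ w → 0 < castVec a ⬝ᵥ W r) ∧ (castVec a ⬝ᵥ w < 0 → castVec a ⬝ᵥ W r < 0) := by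
    rw [Filter.eventually_all_finset]
    intro a _
    have hc : Continuous fun r => castVec a ⬝ᵥ W r := by
      simp only [dotProduct]
      fun_prop
    have ht := hc.tendsto b
    rw [hWb] at ht
    refine Filter.Eventually.and ?_ ?_
    · by_cases h : 0 < castVec a ⬝ᵥ w
      · filter_upwards [ht.eventually_const_lt h] with r hr _ using hr
      · exact Filter.Eventually.of_forall fun _ h' => absurd h' h
    · by_cases h : castVec a ⬝ᵥ w < 0
      · filter_upwards [ht.eventually_lt_const h] with r hr _ using hr
      · exact Filter.Eventually.of_forall fun _ h' => absurd h' h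
  have hdense : DenseRange (Pi.map fun _ => ((↑) : ℚ → ℝ) :
      (Module.Basis.ofVectorSpaceIndex ℚ ℝ → ℚ) → _) :=
    DenseRange.piMap fun _ => Rat.denseRange_cast
  obtain ⟨q, hq⟩ := hdense.exists_mem_open isOpen_interior ⟨_, mem_interior_iff_mem_nhds.2 hopen⟩
  replace hq := interior_subset hq
  set p : Fin d → ℚ := fun i => ∑ j ∈ J, b.repr (w i) j * q j with hp
  have hWp : W (Pi.map (fun _ => ((↑) : ℚ → ℝ)) q) = fun i => (p i : ℝ) := by
    ext i
    simp [W, hp]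
  set N : ℕ := ∏ i, (p i).den with hN
  have hN0 : 0 < N := Finset.prod_pos fun i _ => (p i).den_pos
  have hint : ∀ i, ∃ z : ℤ, (z : ℝ) = N * p i := by
    intro i
    obtain ⟨k, hk⟩ := Finset.dvd_prod_of_mem (fun i => (p i).den) (Finset.mem_univ i)
    refine ⟨k * (p i).num, ?_⟩
    have : (N : ℚ) * p i = (k * (p i).num : ℤ) := by
      rw [hN, hk]
      push_cast
      rw [← Rat.mul_den_eq_num]
      ring
    exact_mod_cast this.symm
  choose z hz using hint
  have hzW : ∀ a : Fin d → ℤ, ((a ⬝ᵥ z : ℤ) : ℝ) =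
      N * (castVec a ⬝ᵥ W (Pi.map (fun _ => ((↑) : ℚ → ℝ)) q)) := by
    intro a
    rw [hWp, ← castVec_dotProduct_castVec]
    have : castVec z = (N : ℝ) • fun i => (p i : ℝ) := by
      ext i
      simp [castVec, hz]
    rw [this, dotProduct_smul, smul_eq_mul]
  have hN0' : (0 : ℝ) < N := by exact_mod_cast hN0
  refine ⟨z, fun a ha => ⟨fun h => ?_, fun h => ?_, fun h => ?_⟩⟩
  · have := hzW a
    rw [hzero a _ h, mul_zero] at this
    exact_mod_cast this
  · have := mul_pos hN0' ((hq a ha).1 h)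
    rw [← hzW a] at this
    exact_mod_cast this
  · have := mul_neg_of_pos_of_neg hN0' ((hq a ha).2 h)
    rw [← hzW a] at this
    exact_mod_cast this

/-- The linear forms that do not vanish on any of finitely many given nonzero vectors are dense. -/
lemma dense_dotProduct_ne_zero {d : ℕ} (S : Finset (Fin d → ℝ)) (hS : ∀ s ∈ S, s ≠ 0) :
    Dense {f : Fin d → ℝ | ∀ s ∈ S, f ⬝ᵥ s ≠ 0} := by
  classical
  have hopen : ∀ s : Fin d → ℝ, IsOpen {f : Fin d → ℝ | f ⬝ᵥ s ≠ 0} := fun s =>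
    isOpen_ne_fun (by simp only [dotProduct]; fun_prop) continuous_const
  induction S using Finset.induction_on with
  | empty => simp
  | insert s S hs ih =>
    have : {f : Fin d → ℝ | ∀ u ∈ insert s S, f ⬝ᵥ u ≠ 0} =
        {f | f ⬝ᵥ s ≠ 0} ∩ {f | ∀ u ∈ S, f ⬝ᵥ u ≠ 0} := by
      ext f; simp
    rw [this]
    refine Dense.inter_of_isOpen_left (fun f => ?_)
      (ih fun u hu => hS u (Finset.mem_insert_of_mem hu)) (hopen s)
    by_cases hf : f ⬝ᵥ s = 0
    · have hss : s ⬝ᵥ s ≠ 0 := fun h => hS s (Finset.mem_insert_self _ _) (dotProduct_self_eq_zero.1 h)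
      have ht : Filter.Tendsto (fun t : ℝ => f + t • s) (nhdsWithin 0 {0}ᶜ) (nhds f) := by
        have : Continuous fun t : ℝ => f + t • s := by fun_prop
        simpa using (this.tendsto 0).mono_left nhdsWithin_le_nhds
      refine mem_closure_of_tendsto ht ?_
      filter_upwards [self_mem_nhdsWithin] with t ht
      simpa [add_dotProduct, hf, hss] using ht
    · exact subset_closure hf

/-- The number of integer points satisfying the inequalities `A` after relaxing the inequality
with normal `a` by `n a`. -/
def relaxedCount {d : ℕ} (A : Finset ((Fin d → ℤ) × ℤ)) (n : (Fin d → ℤ) → ℤ) : ℕ :=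
  {x : Fin d → ℤ | ∀ q ∈ A, q.1 ⬝ᵥ x - q.2 ≤ n q.1}.ncard

/-- The floor of an infinitesimal of the same sign as `k`. -/
def infFloor (k : ℤ) : ℤ := if k < 0 then -1 else 0

/-- The floor of an infinitesimal lexicographically of the same sign as `(a ⬝ᵥ e, a ⬝ᵥ w)`. -/
def lexFloor {d : ℕ} (e w a : Fin d → ℤ) : ℤ :=
  if a ⬝ᵥ e = 0 then infFloor (a ⬝ᵥ w) else infFloor (a ⬝ᵥ e)

lemma relaxedCount_congr {d : ℕ} {A : Finset ((Fin d → ℤ) × ℤ)} {n n' : (Fin d → ℤ) → ℤ}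
    (h : ∀ q ∈ A, n q.1 = n' q.1) : relaxedCount A n = relaxedCount A n' := by
  unfold relaxedCount
  congr 1
  ext x
  exact forall₂_congr fun q hq => by rw [h q hq]

lemma relaxedCount_add_dotProduct {d : ℕ} (A : Finset ((Fin d → ℤ) × ℤ)) (n : (Fin d → ℤ) → ℤ)
    (z : Fin d → ℤ) : relaxedCount A (fun a => a ⬝ᵥ z + n a) = relaxedCount A n := by
  unfold relaxedCount
  rw [← Set.ncard_image_of_injective {x : Fin d → ℤ | ∀ q ∈ A, q.1 ⬝ᵥ x - q.2 ≤ n q.1}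
    (add_left_injective z)]
  congr 1
  ext x
  constructor
  · intro h
    refine ⟨x - z, fun q hq => ?_, sub_add_cancel _ _⟩
    have := h q hq
    rw [dotProduct_sub]
    linarith
  · rintro ⟨y, hy, rfl⟩ q hq
    have := hy q hq
    rw [dotProduct_add]
    linarith

lemma mem_vadd_set_iff_sub_mem {d : ℕ} {P : Set (Fin d → ℝ)} {c x : Fin d → ℝ} :
    x ∈ c +ᵥ P ↔ x - c ∈ P := by
  rw [Set.mem_vadd_set_iff_neg_vadd_mem, vadd_eq_add, neg_add_eq_sub]

lemma latCount_vadd_eq_relaxedCount {d : ℕ} {P : Set (Fin d → ℝ)} {A : Finset ((Fin d → ℤ) × ℤ)}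
    (hA : ∀ x, x ∈ P ↔ ∀ q ∈ A, castVec q.1 ⬝ᵥ x ≤ q.2) (c : Fin d → ℝ) :
    latCount (c +ᵥ P) = relaxedCount A fun a => ⌊castVec a ⬝ᵥ c⌋ := by
  unfold latCount relaxedCount
  congr 1
  ext x
  simp only [Set.mem_ofPred_eq, mem_vadd_set_iff_sub_mem, hA]
  refine forall₂_congr fun q _ => ?_
  rw [Int.le_floor, dotProduct_sub, castVec_dotProduct_castVec]
  push_cast
  constructor <;> intro h <;> linarith

lemma relaxedCount_floor_div_eq {d : ℕ} {P : Set (Fin d → ℝ)} {A : Finset ((Fin d → ℤ) × ℤ)}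
    (hA : ∀ x, x ∈ P ↔ ∀ q ∈ A, castVec q.1 ⬝ᵥ x ≤ q.2)
    (hP : ∀ c : Fin d → ℚ, (∀ i, Odd (c i).den) →
      latCount (ratVec c +ᵥ P) = latCount ((2 • ratVec c) +ᵥ P))
    (m : Fin d → ℤ) {N : ℕ} (hN : Odd N) (r : ℕ) :
    relaxedCount A (fun a => ⌊((2 ^ r * (a ⬝ᵥ m) : ℤ) : ℝ) / N⌋) =
      relaxedCount A (fun a => ⌊((a ⬝ᵥ m : ℤ) : ℝ) / N⌋) := by
  have hc : ∀ (s : ℕ) (a : Fin d → ℤ), castVec a ⬝ᵥ ratVec (fun i => ((2 ^ s * m i : ℤ) : ℚ) / N) =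
      ((2 ^ s * (a ⬝ᵥ m) : ℤ) : ℝ) / N := by
    intro s a
    simp only [dotProduct, castVec, ratVec]
    push_cast
    rw [Finset.mul_sum, Finset.sum_div]
    exact Finset.sum_congr rfl fun i _ => by ring
  induction r with
  | zero => simp
  | succ r ih =>
    rw [← ih]
    have := hP (fun i => ((2 ^ r * m i : ℤ) : ℚ) / N) fun i => by
      have h : ((((2 ^ r * m i : ℤ) : ℚ) / N).den : ℤ) ∣ (N : ℤ) := by
        exact_mod_cast Rat.den_dvd (2 ^ r * m i) N
      exact hN.of_dvd_nat (by exact_mod_cast h)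
    rw [latCount_vadd_eq_relaxedCount hA, latCount_vadd_eq_relaxedCount hA] at this
    simp only [dotProduct_smul, hc] at this
    rw [this]
    refine relaxedCount_congr fun q _ => ?_
    congr 1
    push_cast
    rw [nsmul_eq_mul]
    push_cast
    ring

lemma floor_div_eq_infFloor {N k : ℤ} (h : |k| < N) (z : ℤ) :
    ⌊((N * z + k : ℤ) : ℝ) / N⌋ = z + infFloor k := by
  have hN : 0 < N := (abs_nonneg k).trans_lt h
  have hN' : (0 : ℝ) < N := by exact_mod_cast hN
  rw [abs_lt] at h
  rw [Int.floor_eq_iff, le_div_iff₀ hN', div_lt_iff₀ hN']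
  unfold infFloor
  split_ifs with hk
  · constructor
    · have : (z + -1) * N ≤ N * z + k := by linarith
      exact_mod_cast this
    · have : N * z + k < (z + -1 + 1) * N := by linarith
      exact_mod_cast this
  · constructor
    · have : (z + 0) * N ≤ N * z + k := by linarith
      exact_mod_cast this
    · have : N * z + k < (z + 0 + 1) * N := by linarith
      exact_mod_cast this

/-- Every finite family of integers is bounded by a power of two. -/
lemma exists_abs_lt_two_pow {ι : Type*} (s : Finset ι) (f : ι → ℤ) :
    ∃ k : ℕ, ∀ i ∈ s, |f i| < 2 ^ k := by
  refine ⟨∑ i ∈ s, (f i).natAbs, fun i hi => ?_⟩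
  have h1 : (f i).natAbs ≤ ∑ i ∈ s, (f i).natAbs :=
    Finset.single_le_sum (f := fun i => (f i).natAbs) (fun _ _ => Nat.zero_le _) hi
  have h2 : (f i).natAbs < 2 ^ (∑ i ∈ s, (f i).natAbs) :=
    Nat.lt_two_pow_self.trans_le (Nat.pow_le_pow_right (by norm_num) h1)
  rw [Int.abs_eq_natAbs]
  exact_mod_cast h2

/-- Invariance under doubling identifies the count at a dyadic point with the count at an
infinitesimal point in the same direction. -/
lemma relaxedCount_dyadic {d : ℕ} {P : Set (Fin d → ℝ)} {A : Finset ((Fin d → ℤ) × ℤ)}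
    (hA : ∀ x, x ∈ P ↔ ∀ q ∈ A, castVec q.1 ⬝ᵥ x ≤ q.2)
    (hP : ∀ c : Fin d → ℚ, (∀ i, Odd (c i).den) →
      latCount (ratVec c +ᵥ P) = latCount ((2 • ratVec c) +ᵥ P))
    (m : Fin d → ℤ) (i : ℕ) (hm : ∀ q ∈ A, (2 ^ i : ℤ) ∣ q.1 ⬝ᵥ m → q.1 ⬝ᵥ m = 0) :
    relaxedCount A (fun a => ⌊((a ⬝ᵥ m : ℤ) : ℝ) / (2 ^ i : ℤ)⌋) =
      relaxedCount A (fun a => infFloor (a ⬝ᵥ m)) := by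
  obtain ⟨t, ht⟩ := exists_abs_lt_two_pow A fun q => |q.1 ⬝ᵥ m| + 2
  have hpos : 0 < t + 1 := t.succ_pos
  have hN : Odd (2 ^ (t + 1) * 2 ^ i - 1 : ℕ) := by
    rw [← pow_add]
    refine Nat.Even.sub_odd (Nat.one_le_two_pow) ?_ odd_one
    exact (Nat.even_pow.2 ⟨even_two, by omega⟩)
  have hNc : ((2 ^ (t + 1) * 2 ^ i - 1 : ℕ) : ℝ) = ((2 ^ (t + 1) * 2 ^ i - 1 : ℤ) : ℝ) := by
    rw [Nat.cast_sub (by rw [← pow_add]; exact Nat.one_le_two_pow)]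
    push_cast
    ring
  have := relaxedCount_floor_div_eq hA hP m hN (t + 1)
  rw [hNc] at this
  refine Eq.trans (relaxedCount_congr fun q hq => ?_)
    (this.trans (relaxedCount_congr fun q hq => ?_))
  all_goals
    have hq' := ht q hq
    have hge : (0 : ℤ) ≤ |q.1 ⬝ᵥ m| := abs_nonneg _
    rw [abs_of_nonneg (by linarith)] at hq'
    have hpow : (2 : ℤ) ^ (t + 1) = 2 ^ t + 2 ^ t := by ring
    generalize hk : q.1 ⬝ᵥ m = k at *
    have hu : |k| + 2 < (2 : ℤ) ^ (t + 1) := by linarith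
    generalize (2 : ℤ) ^ (t + 1) = u at *
    have hi0 : (1 : ℤ) ≤ 2 ^ i := one_le_pow₀ (by norm_num)
  · rcases eq_or_ne k 0 with rfl | hk0
    · simp
    have hd : ¬ (2 ^ i : ℤ) ∣ k := fun h => hk0 (by rw [← hk]; exact hm q hq (by rwa [hk]))
    generalize (2 : ℤ) ^ i = v at *
    have hr0 : 0 < k % v := lt_of_le_of_ne (Int.emod_nonneg _ (by omega))
      (fun h => hd (Int.dvd_of_emod_eq_zero h.symm))
    have hr1 : k % v < v := Int.emod_lt_of_pos _ (by omega)
    have hdm := Int.mul_ediv_add_emod k v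
    set r := k % v
    set z := k / v
    have hz : |z| ≤ |k| := Int.abs_ediv_le_abs k v
    have h1 : ⌊((k : ℤ) : ℝ) / v⌋ = z := by
      have := floor_div_eq_infFloor (N := v) (k := r) (by rw [abs_of_pos hr0]; exact hr1) z
      rw [hdm] at this
      rw [this, infFloor, if_neg (by omega), add_zero]
    have h2 := abs_le.1 hz
    have h3 : 0 ≤ z + u * r := by nlinarith
    have h4 : z + u * r < u * v - 1 := by nlinarith
    have h5 := floor_div_eq_infFloor (N := u * v - 1) (k := z + u * r)
      (by rw [abs_of_nonneg h3]; exact h4) z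
    have h6 : (u * v - 1) * z + (z + u * r) = u * k := by rw [← hdm]; ring
    rw [h1, ← h6, h5, infFloor, if_neg (by omega), add_zero]
  · have h5 := floor_div_eq_infFloor (N := u * 2 ^ i - 1) (k := k) (by nlinarith) 0
    rw [mul_zero, zero_add, zero_add] at h5
    exact h5

/-- Invariance under doubling makes the count at an infinitesimal point depend only on the linear
forms vanishing at that point. -/
lemma relaxedCount_lexFloor_eq {d : ℕ} {P : Set (Fin d → ℝ)} {A : Finset ((Fin d → ℤ) × ℤ)}
    (hA : ∀ x, x ∈ P ↔ ∀ q ∈ A, castVec q.1 ⬝ᵥ x ≤ q.2)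
    (hP : ∀ c : Fin d → ℚ, (∀ i, Odd (c i).den) →
      latCount (ratVec c +ᵥ P) = latCount ((2 • ratVec c) +ᵥ P))
    (e w w' : Fin d → ℤ)
    (h : ∀ q ∈ A, q.1 ⬝ᵥ e = 0 → (q.1 ⬝ᵥ w = 0 ↔ q.1 ⬝ᵥ w' = 0)) :
    relaxedCount A (lexFloor e w) = relaxedCount A (lexFloor e w') := by
  obtain ⟨k, hk⟩ := exists_abs_lt_two_pow A
    fun q => |q.1 ⬝ᵥ e| + |q.1 ⬝ᵥ w| + |q.1 ⬝ᵥ w'|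
  set M : ℤ := 2 ^ k with hM
  have hM1 : (1 : ℤ) ≤ M := one_le_pow₀ (by norm_num)
  have hbd : ∀ q ∈ A, |q.1 ⬝ᵥ e| < M ∧ |q.1 ⬝ᵥ w| < M ∧ |q.1 ⬝ᵥ w'| < M := by
    intro q hq
    have h1 := abs_nonneg (q.1 ⬝ᵥ e)
    have h2 := abs_nonneg (q.1 ⬝ᵥ w)
    have h3 := abs_nonneg (q.1 ⬝ᵥ w')
    have h4 := hk q hq
    rw [abs_of_nonneg (by positivity)] at h4
    refine ⟨?_, ?_, ?_⟩ <;> linarith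
  have hMM : (2 : ℤ) ^ (k + k) = M * M := by rw [pow_add]
  have hdot : ∀ a : Fin d → ℤ, a ⬝ᵥ (M • e + w + (M * M) • (w' + M • e)) =
      M * M * (a ⬝ᵥ (w' + M • e)) + (M * (a ⬝ᵥ e) + a ⬝ᵥ w) := by
    intro a
    simp only [dotProduct_add, dotProduct_smul, smul_eq_mul]
    ring
  have hsmall : ∀ q ∈ A, |M * (q.1 ⬝ᵥ e) + q.1 ⬝ᵥ w| < M * M := by
    intro q hq
    obtain ⟨h1, h2, -⟩ := hbd q hq
    rw [abs_lt] at *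
    constructor <;> nlinarith
  have hinf : ∀ q ∈ A, infFloor (M * (q.1 ⬝ᵥ e) + q.1 ⬝ᵥ w) = lexFloor e w q.1 ∧
      (q.1 ⬝ᵥ e ≠ 0 → M * (q.1 ⬝ᵥ e) + q.1 ⬝ᵥ w ≠ 0) := by
    intro q hq
    obtain ⟨-, h2, -⟩ := hbd q hq
    rw [abs_lt] at h2
    unfold lexFloor
    rcases lt_trichotomy (q.1 ⬝ᵥ e) 0 with h0 | h0 | h0
    · have : M * (q.1 ⬝ᵥ e) + q.1 ⬝ᵥ w < 0 := by nlinarith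
      simp [infFloor, h0, h0.ne, this, this.ne]
    · simp [h0]
    · have : 0 < M * (q.1 ⬝ᵥ e) + q.1 ⬝ᵥ w := by nlinarith
      simp [infFloor, h0.ne', this.ne', not_lt.2 h0.le, not_lt.2 this.le]
  have := relaxedCount_dyadic hA hP (M • e + w + (M * M) • (w' + M • e)) (k + k) (by
    intro q hq hdvd
    rw [hMM, hdot] at hdvd
    have h1 : M * (q.1 ⬝ᵥ e) + q.1 ⬝ᵥ w = 0 :=
      Int.eq_zero_of_abs_lt_dvd ((Int.dvd_add_right (dvd_mul_right _ _)).1 hdvd) (hsmall q hq)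
    have h2 : q.1 ⬝ᵥ e = 0 := by
      by_contra h2
      exact (hinf q hq).2 h2 h1
    have h3 : q.1 ⬝ᵥ w = 0 := by simpa [h2] using h1
    have h4 := (h q hq h2).1 h3
    rw [hdot, h1, dotProduct_add, dotProduct_smul, h2, h4]
    simp)
  rw [← relaxedCount_add_dotProduct A (lexFloor e w) (w' + M • e)]
  refine Eq.trans (relaxedCount_congr fun q hq => ?_)
    (this.trans (relaxedCount_congr fun q hq => ?_))
  · rw [hMM, hdot, floor_div_eq_infFloor (hsmall q hq), (hinf q hq).1]
  · rw [hdot]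
    have h1 := abs_lt.1 (hsmall q hq)
    obtain ⟨-, -, h3⟩ := hbd q hq
    rw [abs_lt] at h3
    unfold lexFloor
    split_ifs with h0
    · rw [dotProduct_add, dotProduct_smul, h0, smul_zero, add_zero]
      have h4 := h q hq h0
      rw [h0, mul_zero, zero_add] at h1
      rw [mul_zero, zero_add]
      rcases lt_trichotomy (q.1 ⬝ᵥ w') 0 with h5 | h5 | h5
      · have : M * M * (q.1 ⬝ᵥ w') + q.1 ⬝ᵥ w < 0 := by nlinarith
        simp [infFloor, h5, this]
      · simp [h5, h4.2 h5]
      · have : 0 < M * M * (q.1 ⬝ᵥ w') + q.1 ⬝ᵥ w := by nlinarith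
        simp [infFloor, not_lt.2 h5.le, not_lt.2 this.le]
    · rw [dotProduct_add, dotProduct_smul, smul_eq_mul]
      rcases lt_or_gt_of_ne h0 with h5 | h5
      · have h6 : q.1 ⬝ᵥ w' + M * (q.1 ⬝ᵥ e) ≤ -1 := by nlinarith
        have : M * M * (q.1 ⬝ᵥ w' + M * q.1 ⬝ᵥ e) + (M * q.1 ⬝ᵥ e + q.1 ⬝ᵥ w) < 0 := by nlinarith
        simp [infFloor, h5, this]
      · have h6 : 1 ≤ q.1 ⬝ᵥ w' + M * (q.1 ⬝ᵥ e) := by nlinarith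
        have : 0 < M * M * (q.1 ⬝ᵥ w' + M * q.1 ⬝ᵥ e) + (M * q.1 ⬝ᵥ e + q.1 ⬝ᵥ w) := by nlinarith
        simp [infFloor, not_lt.2 h5.le, not_lt.2 this.le]

lemma floor_dotProduct_smul_add {d : ℕ} {a e : Fin d → ℤ} {w : Fin d → ℝ} {δ : ℝ} (hδ : 0 < δ)
    (h1 : δ * |castVec a ⬝ᵥ castVec e| ≤ 1 / 2) (h2 : |castVec a ⬝ᵥ w| < δ)
    (h3 : |castVec a ⬝ᵥ w| < 1 / 2) :
    ⌊castVec a ⬝ᵥ (δ • castVec e + w)⌋ =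
      if a ⬝ᵥ e = 0 then (if castVec a ⬝ᵥ w < 0 then -1 else 0) else infFloor (a ⬝ᵥ e) := by
  rw [dotProduct_add, dotProduct_smul, smul_eq_mul]
  rw [castVec_dotProduct_castVec] at h1 ⊢
  rw [abs_lt] at h2 h3
  rw [Int.floor_eq_iff]
  unfold infFloor
  rcases lt_trichotomy (a ⬝ᵥ e) 0 with h0 | h0 | h0
  · have h4 : ((a ⬝ᵥ e : ℤ) : ℝ) ≤ -1 := by exact_mod_cast Int.le_sub_one_of_lt h0
    rw [abs_of_neg (by linarith)] at h1
    rw [if_neg h0.ne, if_pos h0]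
    push_cast
    constructor <;> nlinarith
  · rw [if_pos h0, h0]
    split_ifs <;> push_cast <;> constructor <;> linarith
  · have h4 : (1 : ℝ) ≤ ((a ⬝ᵥ e : ℤ) : ℝ) := by exact_mod_cast h0
    rw [abs_of_pos (by linarith)] at h1
    rw [if_neg h0.ne', if_neg h0.not_gt]
    push_cast
    constructor <;> nlinarith

/-- Near `δ • e`, the number of lattice points of a translate of `P` is a combination of
indicators of linear subspaces. -/
lemma exists_latCount_eq_sum_indicator {d : ℕ} {P : Set (Fin d → ℝ)}
    {A : Finset ((Fin d → ℤ) × ℤ)}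
    (hA : ∀ x, x ∈ P ↔ ∀ q ∈ A, castVec q.1 ⬝ᵥ x ≤ q.2)
    (hP : ∀ c : Fin d → ℚ, (∀ i, Odd (c i).den) →
      latCount (ratVec c +ᵥ P) = latCount ((2 • ratVec c) +ᵥ P))
    (e : Fin d → ℤ) {δ : ℝ} (hδ : 0 < δ)
    (hδe : ∀ q ∈ A, δ * |castVec q.1 ⬝ᵥ castVec e| ≤ 1 / 2) :
    ∃ (B : Finset (Finset (Fin d → ℤ))) (β : Finset (Fin d → ℤ) → ℝ),
      ∀ w : Fin d → ℝ, (∀ q ∈ A, |castVec q.1 ⬝ᵥ w| < δ ∧ |castVec q.1 ⬝ᵥ w| < 1 / 2) →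
        (latCount ((δ • castVec e + w) +ᵥ P) : ℝ) =
          ∑ S ∈ B with ∀ a ∈ S, castVec a ⬝ᵥ w = 0, β S := by
  classical
  set E := (A.image Prod.fst).filter (fun a => a ⬝ᵥ e = 0) with hE
  let κ : Finset (Fin d → ℤ) → ℝ := fun Z =>
    if h : ∃ w' : Fin d → ℤ, E.filter (fun a => a ⬝ᵥ w' = 0) = Z then
      relaxedCount A (lexFloor e h.choose) else 0
  obtain ⟨β, hβ⟩ := exists_eq_sum_powerset κ
  refine ⟨E.powerset, β, fun w hw => ?_⟩
  · obtain ⟨w', hw'⟩ := exists_integer_same_signs (A.image Prod.fst) w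
    have hw'0 : ∀ a ∈ A.image Prod.fst, (castVec a ⬝ᵥ w = 0 ↔ a ⬝ᵥ w' = 0) := by
      intro a ha
      obtain ⟨h1, h2, h3⟩ := hw' a ha
      refine ⟨h1, fun h => ?_⟩
      rcases lt_trichotomy (castVec a ⬝ᵥ w) 0 with h0 | h0 | h0
      · exact absurd h (h3 h0).ne
      · exact h0
      · exact absurd h (h2 h0).ne'
    have hκ : (latCount ((δ • castVec e + w) +ᵥ P) : ℝ) =
        κ (E.filter fun a => castVec a ⬝ᵥ w = 0) := by
      have hex : ∃ w'' : Fin d → ℤ, E.filter (fun a => a ⬝ᵥ w'' = 0) =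
          E.filter fun a => castVec a ⬝ᵥ w = 0 :=
        ⟨w', Finset.filter_congr fun a ha => (hw'0 a (Finset.mem_filter.1 ha).1).symm⟩
      simp only [κ, dif_pos hex]
      rw [latCount_vadd_eq_relaxedCount hA]
      norm_cast
      trans relaxedCount A (lexFloor e w')
      · refine relaxedCount_congr fun q hq => ?_
        rw [floor_dotProduct_smul_add hδ (hδe q hq) (hw q hq).1 (hw q hq).2]
        unfold lexFloor
        congr 1
        obtain ⟨-, h2, h3⟩ := hw' q.1 (Finset.mem_image_of_mem _ hq)
        have h1 := hw'0 q.1 (Finset.mem_image_of_mem _ hq)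
        unfold infFloor
        congr 1
        refine propext ⟨h3, fun h => ?_⟩
        by_contra! h0
        rcases h0.eq_or_lt with h0 | h0
        · exact h.ne (h1.1 h0.symm)
        · exact (h2 h0).not_gt h
      · refine relaxedCount_lexFloor_eq hA hP e _ _ fun q hq hqe => ?_
        have hqE : q.1 ∈ E := Finset.mem_filter.2 ⟨Finset.mem_image_of_mem _ hq, hqe⟩
        have := Finset.ext_iff.1 hex.choose_spec q.1
        simp only [Finset.mem_filter, hqE, true_and] at this
        rw [this, hw'0 q.1 (Finset.mem_image_of_mem _ hq)]
    rw [hκ, hβ]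
    refine Finset.sum_congr ?_ fun _ _ => rfl
    ext S
    simp only [Finset.mem_powerset, Finset.mem_filter]
    constructor
    · exact fun h => ⟨fun a ha => (Finset.mem_filter.1 (h ha)).1,
        fun a ha => (Finset.mem_filter.1 (h ha)).2⟩
    · exact fun h a ha => Finset.mem_filter.2 ⟨h.1 ha, h.2 a ha⟩

open Classical in
/-- If a combination of indicators of closed convex sets containing the origin vanishes near the
origin, the total weight of the sets meeting an open half-space bounded by a hyperplane through
the origin is zero. -/
lemma sum_exists_dotProduct_neg_eq_zero {d : ℕ} {ι : Type*} (s : Finset ι) (α : ι → ℝ)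
    (C : ι → Set (Fin d → ℝ)) (hC : ∀ i ∈ s, IsClosed (C i)) (hconv : ∀ i ∈ s, Convex ℝ (C i))
    (h0 : ∀ i ∈ s, 0 ∈ C i)
    (h : ∀ᶠ x in nhds (0 : Fin d → ℝ), ∑ i ∈ s, (if x ∈ C i then α i else 0) = 0)
    (φ : Fin d → ℝ) :
    ∑ i ∈ s, (if ∃ x ∈ C i, φ ⬝ᵥ x < 0 then α i else 0) = 0 := by
  have hu : ∀ i, ∃ u : Fin d → ℝ, i ∈ s → (∃ x ∈ C i, φ ⬝ᵥ x < 0) →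
      φ ⬝ᵥ u = -1 ∧ ∀ᶠ ε in nhdsWithin (0 : ℝ) (Set.Ioi 0), ε • u ∈ C i := by
    intro i
    by_cases hi : i ∈ s ∧ ∃ x ∈ C i, φ ⬝ᵥ x < 0
    · obtain ⟨hi, x, hx, hφ⟩ := hi
      refine ⟨(-(φ ⬝ᵥ x))⁻¹ • x, fun _ _ => ⟨?_, ?_⟩⟩
      · rw [dotProduct_smul, smul_eq_mul, inv_neg, neg_mul, inv_mul_cancel₀ hφ.ne]
      · have hc : 0 < -(φ ⬝ᵥ x) := by linarith
        filter_upwards [Ioo_mem_nhdsGT hc] with ε hε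
        rw [smul_smul]
        refine (hconv i hi).smul_mem_of_zero_mem (h0 i hi) hx ⟨?_, ?_⟩
        · exact mul_nonneg hε.1.le (inv_nonneg.2 hc.le)
        · rw [mul_inv_le_iff₀ hc, one_mul]
          exact hε.2.le
    · exact ⟨0, fun h1 h2 => absurd ⟨h1, h2⟩ hi⟩
  choose u hu using hu
  obtain ⟨r, hr, hball⟩ := Metric.nhds_basis_closedBall.eventually_iff.1 h
  set R := 1 + ∑ i ∈ s, ‖u i‖ with hR
  have hR0 : 0 < R := add_pos_of_pos_of_nonneg one_pos (Finset.sum_nonneg fun _ _ => norm_nonneg _)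
  have huR : ∀ i ∈ s, ‖u i‖ ≤ R := fun i hi =>
    (Finset.single_le_sum (f := fun i => ‖u i‖) (fun _ _ => norm_nonneg _) hi).trans (by linarith)
  have hev : ∀ᶠ ε in nhdsWithin (0 : ℝ) (Set.Ioi 0), ∀ i ∈ s, (∃ x ∈ C i, φ ⬝ᵥ x < 0) →
      ε • u i ∈ C i := by
    rw [Filter.eventually_all_finset]
    intro i hi
    by_cases hx : ∃ x ∈ C i, φ ⬝ᵥ x < 0
    · filter_upwards [(hu i hi hx).2] with ε hε _ using hε
    · exact Filter.Eventually.of_forall fun _ h => absurd h hx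
  obtain ⟨ε, hεu, hε0, hεr⟩ := (hev.and (Ioo_mem_nhdsGT (div_pos hr hR0))).exists
  rw [lt_div_iff₀ hR0] at hεr
  have hD : Convex ℝ {w : Fin d → ℝ | φ ⬝ᵥ w = -ε} := by
    intro x hx y hy a b _ _ hab
    simp only [Set.mem_ofPred_eq] at hx hy ⊢
    rw [dotProduct_add, dotProduct_smul, dotProduct_smul, hx, hy, ← add_smul, hab, one_smul]
  have hDc : IsClosed {w : Fin d → ℝ | φ ⬝ᵥ w = -ε} :=
    isClosed_eq (Continuous.dotProduct continuous_const continuous_id) continuous_const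
  set D := {w : Fin d → ℝ | φ ⬝ᵥ w = -ε} ∩ Metric.closedBall 0 (ε * R) with hDdef
  refine Eq.trans (Finset.sum_congr rfl fun i hi => if_congr ?_ rfl rfl)
    (sum_nonempty_eq_zero_of_sum_indicator_eq_zero s α (fun i => C i ∩ D)
    (fun i hi => ?_) (fun i hi => ?_) fun x => ?_)
  · constructor
    · intro hx
      refine ⟨ε • u i, hεu i hi hx, ?_, ?_⟩
      · simp [dotProduct_smul, (hu i hi hx).1]
      · rw [mem_closedBall_zero_iff, norm_smul, Real.norm_of_nonneg hε0.le]
        exact mul_le_mul_of_nonneg_left (huR i hi) hε0.le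
    · rintro ⟨x, hx, hφ, -⟩
      refine ⟨x, hx, ?_⟩
      rw [Set.mem_ofPred_eq] at hφ
      rw [hφ]
      linarith
  · exact ((isCompact_closedBall _ _).inter_left hDc).inter_left (hC i hi)
  · exact (hconv i hi).inter (hD.inter (convex_closedBall _ _))
  · by_cases hx : x ∈ D
    · simp only [Set.mem_inter_iff, hx, and_true]
      exact hball (Metric.closedBall_subset_closedBall hεr.le hx.2)
    · simp [hx]

/-- If near the origin the number of points `y ∈ Y` with `y - w ∈ P` is a combination of
indicators of subspaces, then the number of points of `Y` that do not maximize a functional on `P`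
is the total weight of the subspaces on which the functional is not zero. -/
lemma card_filter_not_maximal_eq {d : ℕ} {ι : Type*} {P : Set (Fin d → ℝ)} (hPc : IsClosed P)
    (hPconv : Convex ℝ P) (Y : Finset (Fin d → ℝ)) (hY : ∀ y ∈ Y, y ∈ P) (B : Finset ι)
    (W : ι → Submodule ℝ (Fin d → ℝ)) (β : ι → ℝ)
    (h : ∀ᶠ w in nhds (0 : Fin d → ℝ),
      ({y ∈ (Y : Set (Fin d → ℝ)) | y - w ∈ P}.ncard : ℝ) =
        ∑ i ∈ B, (W i : Set _).indicator (fun _ => β i) w)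
    (φ : Fin d → ℝ) :
    ({y ∈ (Y : Set (Fin d → ℝ)) | ∃ z ∈ P, φ ⬝ᵥ y < φ ⬝ᵥ z}.ncard : ℝ) =
      ∑ i ∈ B, {i | ∃ w ∈ W i, φ ⬝ᵥ w ≠ 0}.indicator β i := by
  classical
  have hcard : ∀ p : (Fin d → ℝ) → Prop, ({y ∈ (Y : Set (Fin d → ℝ)) | p y}.ncard : ℝ) =
      ∑ y ∈ Y, if p y then (1 : ℝ) else 0 := by
    intro p
    rw [Finset.sum_boole, ← Set.ncard_coe_finset, Finset.coe_filter]
    rfl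
  have key := sum_exists_dotProduct_neg_eq_zero (Y.disjSum B) (Sum.elim (fun _ => 1) fun i => -β i)
    (Sum.elim (fun y => {w | y - w ∈ P}) fun i => (W i : Set (Fin d → ℝ))) ?_ ?_ ?_ ?_ φ
  · rw [Finset.sum_disjSum] at key
    simp only [Sum.elim_inl, Sum.elim_inr, Set.mem_ofPred_eq, SetLike.mem_coe] at key
    have h1 : ∀ y : Fin d → ℝ, (∃ w, y - w ∈ P ∧ φ ⬝ᵥ w < 0) ↔ ∃ z ∈ P, φ ⬝ᵥ y < φ ⬝ᵥ z := by
      intro y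
      constructor
      · rintro ⟨w, hw, hφ⟩
        refine ⟨_, hw, ?_⟩
        rw [dotProduct_sub]
        linarith
      · rintro ⟨z, hz, hφ⟩
        refine ⟨y - z, by simpa using hz, ?_⟩
        rw [dotProduct_sub]
        linarith
    have h2 : ∀ i, (∃ w ∈ W i, φ ⬝ᵥ w < 0) ↔ ∃ w ∈ W i, φ ⬝ᵥ w ≠ 0 := by
      intro i
      constructor
      · exact fun ⟨w, hw, hφ⟩ => ⟨w, hw, hφ.ne⟩
      · rintro ⟨w, hw, hφ⟩
        rcases hφ.lt_or_gt with hφ | hφ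
        · exact ⟨w, hw, hφ⟩
        · exact ⟨-w, neg_mem hw, by rw [dotProduct_neg]; linarith⟩
    simp only [h1, h2] at key
    rw [hcard]
    simp only [Set.indicator_apply, Set.mem_ofPred_eq]
    have h3 : ∀ i, (if ∃ w ∈ W i, φ ⬝ᵥ w ≠ 0 then -β i else 0) =
        -(if ∃ w ∈ W i, φ ⬝ᵥ w ≠ 0 then β i else 0) := by
      intro i; split_ifs <;> simp
    simp only [h3, Finset.sum_neg_distrib] at key
    linarith
  · rintro (y | i) -
    · exact hPc.preimage (continuous_const.sub continuous_id)
    · exact (W i).closed_of_finiteDimensional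
  · rintro (y | i) -
    · intro w hw w' hw' a b ha hb hab
      have := hPconv hw hw' ha hb hab
      have h' : a • (y - w) + b • (y - w') = y - (a • w + b • w') := by
        rw [smul_sub, smul_sub, sub_add_sub_comm, ← add_smul, hab, one_smul]
      rwa [h'] at this
    · exact (W i).convex
  · rintro (y | i) hi
    · simpa using hY y (by simpa using hi)
    · exact (W i).zero_mem
  · filter_upwards [h] with w hw
    rw [hcard] at hw
    rw [Finset.sum_disjSum]
    simp only [Sum.elim_inl, Sum.elim_inr, Set.mem_ofPred_eq, SetLike.mem_coe]
    simp only [Set.indicator_apply, SetLike.mem_coe] at hw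
    have h3 : ∀ i, (if w ∈ W i then -β i else 0) = -(if w ∈ W i then β i else 0) := by
      intro i; split_ifs <;> simp
    simp only [h3, Finset.sum_neg_distrib]
    rw [← sub_eq_add_neg, sub_eq_zero]
    convert hw using 2
    exact if_congr Iff.rfl rfl rfl

lemma finite_setOf_castVec_mem {d : ℕ} {K : Set (Fin d → ℝ)} (hK : IsCompact K) :
    {x : Fin d → ℤ | castVec x ∈ K}.Finite := by
  obtain ⟨r, hr⟩ := hK.isBounded.exists_norm_le
  refine (Set.finite_Icc (fun _ : Fin d => -⌈r⌉) (fun _ => ⌈r⌉)).subset fun x hx => ?_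
  have h : ∀ i, |(x i : ℝ)| ≤ ⌈r⌉ := fun i =>
    (norm_le_pi_norm (castVec x) i).trans ((hr _ hx).trans (Int.le_ceil r))
  refine ⟨fun i => ?_, fun i => ?_⟩
  · exact_mod_cast (abs_le.1 (h i)).1
  · exact_mod_cast (abs_le.1 (h i)).2

/-- The common kernel of the linear forms in `S`. -/
def commonKer {d : ℕ} (S : Finset (Fin d → ℤ)) : Submodule ℝ (Fin d → ℝ) where
  carrier := {w | ∀ a ∈ S, castVec a ⬝ᵥ w = 0}
  add_mem' hx hy a ha := by rw [dotProduct_add, hx a ha, hy a ha, add_zero]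
  zero_mem' a _ := dotProduct_zero _
  smul_mem' c x hx a ha := by rw [dotProduct_smul, hx a ha, smul_zero]

lemma castVec_injective {d : ℕ} : Function.Injective (castVec : (Fin d → ℤ) → Fin d → ℝ) :=
  fun x y h => funext fun i => by simpa [castVec] using congrFun h i

lemma exists_pos_forall_mul_lt {ι : Type*} (s : Finset ι) (f : ι → ℝ) {c : ℝ} (hc : 0 < c) :
    ∃ δ > 0, ∀ i ∈ s, δ * f i < c := by
  have : ∀ᶠ δ in nhdsWithin (0 : ℝ) (Set.Ioi 0), ∀ i ∈ s, δ * f i < c := by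
    rw [Filter.eventually_all_finset]
    intro i _
    have : Filter.Tendsto (fun δ : ℝ => δ * f i) (nhdsWithin 0 (Set.Ioi 0)) (nhds (0 * f i)) :=
      ((continuous_id.mul continuous_const).tendsto 0).mono_left nhdsWithin_le_nhds
    rw [zero_mul] at this
    exact this.eventually_lt_const hc
  obtain ⟨δ, h, h0⟩ := (this.and self_mem_nhdsWithin).exists
  exact ⟨δ, h0, h⟩

/-- The lattice points of a slight shift of `P` along `e` that maximize a functional vanishing on
`e`. -/
def maximalLatticePoints {d : ℕ} (P : Set (Fin d → ℝ)) (p φ : Fin d → ℝ) : Set (Fin d → ℤ) :=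
  {x | castVec x - p ∈ P ∧ ∀ z ∈ P, φ ⬝ᵥ z ≤ φ ⬝ᵥ (castVec x - p)}

lemma exists_ncard_maximalLatticePoints_eq {d : ℕ} {P : Set (Fin d → ℝ)}
    {A : Finset ((Fin d → ℤ) × ℤ)}
    (hA : ∀ x, x ∈ P ↔ ∀ q ∈ A, castVec q.1 ⬝ᵥ x ≤ q.2)
    (hP : ∀ c : Fin d → ℚ, (∀ i, Odd (c i).den) →
      latCount (ratVec c +ᵥ P) = latCount ((2 • ratVec c) +ᵥ P))
    (hPc : IsCompact P) (hPconv : Convex ℝ P) (e : Fin d → ℤ) :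
    ∃ δ > (0 : ℝ), (∀ i, δ * |(e i : ℝ)| < 1) ∧ ∃ S : Finset (Fin d → ℝ),
      (∀ s ∈ S, s ∉ ℝ ∙ castVec e) ∧ ∃ M : ℝ, ∀ φ : Fin d → ℝ, φ ⬝ᵥ castVec e = 0 →
        (∀ s ∈ S, φ ⬝ᵥ s ≠ 0) → (maximalLatticePoints P (δ • castVec e) φ).ncard = M := by
  classical
  obtain ⟨δ₁, hδ₁, h₁⟩ := exists_pos_forall_mul_lt Finset.univ (fun i => |(e i : ℝ)|) one_pos
  obtain ⟨δ₂, hδ₂, h₂⟩ := exists_pos_forall_mul_lt A (fun q => |castVec q.1 ⬝ᵥ castVec e|)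
    (one_half_pos (α := ℝ))
  obtain ⟨δ, hδ, hδ1, hδ2⟩ : ∃ δ > 0, δ ≤ δ₁ ∧ δ ≤ δ₂ :=
    ⟨min δ₁ δ₂, lt_min hδ₁ hδ₂, min_le_left _ _, min_le_right _ _⟩
  have h1 : ∀ i, δ * |(e i : ℝ)| < 1 := fun i =>
    (mul_le_mul_of_nonneg_right hδ1 (abs_nonneg _)).trans_lt (h₁ i (Finset.mem_univ i))
  have h2 : ∀ q ∈ A, δ * |castVec q.1 ⬝ᵥ castVec e| ≤ 1 / 2 := fun q hq =>
    (mul_le_mul_of_nonneg_right hδ2 (abs_nonneg _)).trans (h₂ q hq).le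
  obtain ⟨B, β, hβ⟩ := exists_latCount_eq_sum_indicator hA hP e hδ h2
  set f : (Fin d → ℤ) → Fin d → ℝ := fun x => castVec x - δ • castVec e with hf
  have hfinj : Function.Injective f := fun x y h => castVec_injective (sub_left_injective h)
  have hXfin : {x | f x ∈ P}.Finite := by
    refine (finite_setOf_castVec_mem (hPc.vadd (δ • castVec e))).subset fun x hx => ?_
    rw [Set.mem_ofPred_eq, mem_vadd_set_iff_sub_mem]
    exact hx
  set Y : Finset (Fin d → ℝ) := hXfin.toFinset.image f with hY
  have hYmem : ∀ y, y ∈ Y ↔ y ∈ P ∧ ∃ x, f x = y := by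
    intro y
    simp only [hY, Finset.mem_image, Set.Finite.mem_toFinset, Set.mem_ofPred_eq]
    constructor
    · rintro ⟨x, hx, rfl⟩
      exact ⟨hx, x, rfl⟩
    · rintro ⟨hx, x, rfl⟩
      exact ⟨x, hx, rfl⟩
  have hsmall : ∀ᶠ w in nhds (0 : Fin d → ℝ),
      ∀ q ∈ A, |castVec q.1 ⬝ᵥ w| < δ ∧ |castVec q.1 ⬝ᵥ w| < 1 / 2 := by
    rw [Filter.eventually_all_finset]
    intro q _
    have : Filter.Tendsto (fun w => |castVec q.1 ⬝ᵥ w|) (nhds 0) (nhds |castVec q.1 ⬝ᵥ 0|) :=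
      (Continuous.dotProduct continuous_const continuous_id).abs.tendsto 0
    rw [dotProduct_zero, abs_zero] at this
    exact (this.eventually_lt_const hδ).and (this.eventually_lt_const one_half_pos)
  have hcount : ∀ w : Fin d → ℝ,
      (∀ q ∈ A, |castVec q.1 ⬝ᵥ w| < δ ∧ |castVec q.1 ⬝ᵥ w| < 1 / 2) →
      ({y ∈ (Y : Set (Fin d → ℝ)) | y - w ∈ P}.ncard : ℝ) =
        ∑ S ∈ B, (commonKer S : Set _).indicator (fun _ => β S) w := by
    intro w hw
    have hind : ∑ S ∈ B, (commonKer S : Set _).indicator (fun _ => β S) w =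
        ∑ S ∈ B with ∀ a ∈ S, castVec a ⬝ᵥ w = 0, β S := by
      rw [Finset.sum_filter]
      refine Finset.sum_congr rfl fun S _ => ?_
      rw [Set.indicator_apply]
      exact if_congr Iff.rfl rfl rfl
    rw [hind, ← hβ w hw, latCount, ← Set.ncard_image_of_injective _ hfinj]
    congr 2
    ext y
    simp only [Set.mem_image, Set.mem_ofPred_eq, Finset.mem_coe, hYmem, mem_vadd_set_iff_sub_mem]
    constructor
    · rintro ⟨⟨hy, x, rfl⟩, hx⟩
      exact ⟨x, by rwa [← sub_sub], rfl⟩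
    · rintro ⟨x, hx, rfl⟩
      refine ⟨⟨?_, x, rfl⟩, by rwa [← sub_sub] at hx⟩
      rw [hA] at hx ⊢
      intro q hq
      have h3 := hx q hq
      have h4 : q.1 ⬝ᵥ x - q.2 ≤ ⌊castVec q.1 ⬝ᵥ (δ • castVec e + w)⌋ := by
        rw [Int.le_floor]
        rw [dotProduct_sub, castVec_dotProduct_castVec] at h3
        push_cast
        linarith
      have h5 : ⌊castVec q.1 ⬝ᵥ (δ • castVec e + w)⌋ ≤ ⌊castVec q.1 ⬝ᵥ (δ • castVec e + 0)⌋ := by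
        rw [floor_dotProduct_smul_add hδ (h2 q hq) (hw q hq).1 (hw q hq).2,
          floor_dotProduct_smul_add hδ (h2 q hq) (by simpa using hδ) (by simp)]
        simp only [dotProduct_zero, lt_irrefl, if_false]
        split_ifs <;> simp
      have h6 := Int.le_floor.1 (h4.trans h5)
      rw [add_zero] at h6
      simp only [hf]
      rw [dotProduct_sub, castVec_dotProduct_castVec]
      push_cast at h6
      linarith
  have hYcard : ((Y : Set (Fin d → ℝ)).ncard : ℝ) = ∑ S ∈ B, β S := by
    have h3 := hcount 0 hsmall.self_of_nhds
    have h4 : {y ∈ (Y : Set (Fin d → ℝ)) | y - 0 ∈ P} = Y := by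
      ext y
      simp only [sub_zero, Finset.mem_coe, Set.mem_ofPred_eq, hYmem]
      tauto
    rw [h4] at h3
    rw [h3]
    exact Finset.sum_congr rfl fun S _ => Set.indicator_of_mem (commonKer S).zero_mem _
  have hs : ∀ S : Finset (Fin d → ℤ), ∃ s : Fin d → ℝ,
      ¬ commonKer S ≤ ℝ ∙ castVec e → s ∈ commonKer S ∧ s ∉ ℝ ∙ castVec e := by
    intro S
    by_cases h : commonKer S ≤ ℝ ∙ castVec e
    · exact ⟨0, fun h' => absurd h h'⟩
    · obtain ⟨s, hs⟩ := SetLike.not_le_iff_exists.1 h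
      exact ⟨s, fun _ => hs⟩
  choose s hs using hs
  refine ⟨δ, hδ, h1, (B.filter fun S => ¬ commonKer S ≤ ℝ ∙ castVec e).image s, ?_,
    ∑ S ∈ B, β S - ∑ S ∈ B, {S | ¬ commonKer S ≤ ℝ ∙ castVec e}.indicator β S, ?_⟩
  · intro x hx
    obtain ⟨S, hS, rfl⟩ := Finset.mem_image.1 hx
    exact (hs S (Finset.mem_filter.1 hS).2).2
  · intro φ hφe hφ
    have hnot := card_filter_not_maximal_eq hPc.isClosed hPconv Y (fun y hy => ((hYmem y).1 hy).1)
      B commonKer β (hsmall.mono hcount) φ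
    have hind : ∑ S ∈ B, {S | ∃ w ∈ commonKer S, φ ⬝ᵥ w ≠ 0}.indicator β S =
        ∑ S ∈ B, {S | ¬ commonKer S ≤ ℝ ∙ castVec e}.indicator β S := by
      refine Finset.sum_congr rfl fun S hS => ?_
      simp only [Set.indicator_apply]
      refine if_congr ?_ rfl rfl
      simp only [Set.mem_ofPred_eq]
      constructor
      · rintro ⟨w, hw, hφw⟩ hle
        obtain ⟨c, rfl⟩ := Submodule.mem_span_singleton.1 (hle hw)
        rw [dotProduct_smul, hφe, smul_zero] at hφw
        exact hφw rfl
      · intro h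
        exact ⟨s S, (hs S h).1,
          hφ _ (Finset.mem_image_of_mem _ (Finset.mem_filter.2 ⟨hS, h⟩))⟩
    rw [← hYcard, ← hind, ← hnot]
    have hmax : f '' maximalLatticePoints P (δ • castVec e) φ =
        (Y : Set (Fin d → ℝ)) \ {y ∈ (Y : Set (Fin d → ℝ)) | ∃ z ∈ P, φ ⬝ᵥ y < φ ⬝ᵥ z} := by
      ext y
      simp only [maximalLatticePoints, Set.mem_image, Set.mem_sdiff, Set.mem_ofPred_eq,
        Finset.mem_coe, hYmem, not_and, not_exists, not_lt]
      constructor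
      · rintro ⟨x, ⟨hx, hmax⟩, rfl⟩
        exact ⟨⟨hx, x, rfl⟩, fun _ => hmax⟩
      · rintro ⟨⟨hy, x, rfl⟩, h⟩
        exact ⟨x, ⟨hy, h ⟨hy, x, rfl⟩⟩, rfl⟩
    rw [← Set.ncard_image_of_injective _ hfinj, hmax, eq_sub_iff_add_eq]
    exact_mod_cast Set.ncard_sdiff_add_ncard_of_subset (Set.sep_subset _ _) Y.finite_toSet

/-- The lattice points of the segment from `δ • e` to `(ℓ + δ) • e`. -/
def segmentLatticePoints {d : ℕ} (e : Fin d → ℤ) (δ ℓ : ℝ) : Set (Fin d → ℤ) :=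
  {x | ∃ s ∈ Set.Icc (0 : ℝ) ℓ, castVec x = (s + δ) • castVec e}

lemma ncard_segmentLatticePoints_lt {d : ℕ} {e : Fin d → ℤ} (he : e ≠ 0) {δ : ℝ} (hδ : 0 < δ)
    (hδe : ∀ i, δ * |(e i : ℝ)| < 1) {ℓ ℓ' : ℝ} (hℓ : 0 ≤ ℓ) (hlt : ℓ < ℓ') {x y : Fin d → ℤ}
    (hx : castVec x = ℓ • castVec e) (hy : castVec y = ℓ' • castVec e) :
    (segmentLatticePoints e δ ℓ).ncard < (segmentLatticePoints e δ ℓ').ncard := by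
  obtain ⟨i, hi⟩ : ∃ i, e i ≠ 0 := Function.ne_iff.1 he
  have hi' : (e i : ℝ) ≠ 0 := by exact_mod_cast hi
  have habs : 0 < |(e i : ℝ)| := abs_pos.2 hi'
  have hδlt : δ < ℓ' - ℓ := by
    have hxi : (x i : ℝ) = ℓ * e i := congrFun hx i
    have hyi : (y i : ℝ) = ℓ' * e i := congrFun hy i
    have h1 : ((y i - x i : ℤ) : ℝ) = (ℓ' - ℓ) * e i := by push_cast; rw [hxi, hyi]; ring
    have h2 : y i - x i ≠ 0 := by
      intro h
      rw [h] at h1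
      have := mul_ne_zero (sub_pos.2 hlt).ne' hi'
      exact this (by rw [← h1]; simp)
    have h3 : (1 : ℝ) ≤ |((y i - x i : ℤ) : ℝ)| := by exact_mod_cast Int.one_le_abs h2
    rw [h1, abs_mul, abs_of_pos (sub_pos.2 hlt)] at h3
    exact lt_of_mul_lt_mul_right ((hδe i).trans_le h3) habs.le
  refine Set.ncard_lt_ncard (Set.ssubset_iff_of_subset ?_ |>.2 ⟨y, ?_, ?_⟩) ?_
  · rintro z ⟨s, hs, hz⟩
    exact ⟨s, ⟨hs.1, hs.2.trans hlt.le⟩, hz⟩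
  · exact ⟨ℓ' - δ, ⟨by linarith, by linarith⟩, by rw [hy, sub_add_cancel]⟩
  · rintro ⟨s, hs, hz⟩
    have h := congrFun (hy.symm.trans hz) i
    have : ℓ' = s + δ := mul_right_cancel₀ hi' h
    linarith [hs.2]
  · have hcomp : IsCompact ((fun s : ℝ => (s + δ) • castVec e) '' Set.Icc 0 ℓ') :=
      isCompact_Icc.image (by fun_prop)
    refine (finite_setOf_castVec_mem hcomp).subset ?_
    rintro z ⟨s, hs, hz⟩
    exact ⟨s, hs, hz.symm⟩

/-- A point of the convex hull of `V` maximizing a functional lies on any segment that contains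
all maximizers of the functional in `V`. -/
lemma exists_eq_add_smul_of_mem_convexHull {d : ℕ} {V : Set (Fin d → ℝ)} {p e φ : Fin d → ℝ}
    {ℓ : ℝ} (hφe : φ ⬝ᵥ e = 0) (hmax : ∀ v ∈ V, φ ⬝ᵥ v ≤ φ ⬝ᵥ p)
    (hseg : ∀ v ∈ V, φ ⬝ᵥ v = φ ⬝ᵥ p → ∃ s ∈ Set.Icc (0 : ℝ) ℓ, v = p + s • e)
    {y : Fin d → ℝ} (hy : y ∈ convexHull ℝ V) :
    φ ⬝ᵥ y < φ ⬝ᵥ p ∨ ∃ s ∈ Set.Icc (0 : ℝ) ℓ, y = p + s • e := by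
  let K : Set (Fin d → ℝ) := {y | φ ⬝ᵥ y < φ ⬝ᵥ p ∨ ∃ s ∈ Set.Icc (0 : ℝ) ℓ, y = p + s • e}
  have hle : ∀ y ∈ K, φ ⬝ᵥ y ≤ φ ⬝ᵥ p := by
    rintro y (hy | ⟨s, -, rfl⟩)
    · exact hy.le
    · rw [dotProduct_add, dotProduct_smul, hφe, smul_zero, add_zero]
  have hK : Convex ℝ K := by
    rw [convex_iff_forall_pos]
    intro x hx y hy a b ha hb hab
    have hx' := hle x hx
    have hy' := hle y hy
    have hm : φ ⬝ᵥ p = a * φ ⬝ᵥ p + b * φ ⬝ᵥ p := by rw [← add_mul, hab, one_mul]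
    rcases hx with hx | ⟨s, hs, rfl⟩
    · left
      rw [dotProduct_add, dotProduct_smul, dotProduct_smul, smul_eq_mul, smul_eq_mul, hm]
      exact add_lt_add_of_lt_of_le (mul_lt_mul_of_pos_left hx ha)
        (mul_le_mul_of_nonneg_left hy' hb.le)
    rcases hy with hy | ⟨t, ht, rfl⟩
    · left
      rw [dotProduct_add, dotProduct_smul, dotProduct_smul, smul_eq_mul, smul_eq_mul, hm]
      exact add_lt_add_of_le_of_lt (mul_le_mul_of_nonneg_left hx' ha.le)
        (mul_lt_mul_of_pos_left hy hb)
    · right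
      refine ⟨a * s + b * t, convex_Icc 0 ℓ hs ht ha.le hb.le hab, ?_⟩
      rw [smul_add, smul_add, add_add_add_comm, ← add_smul, hab, one_smul, smul_smul, smul_smul,
        ← add_smul]
  refine convexHull_min (fun v hv => ?_) hK hy
  rcases (hmax v hv).lt_or_eq with h | h
  · exact Or.inl h
  · exact Or.inr (hseg v hv h)

/-- The edge lengths of `P` in a given direction all agree. -/
lemma exists_edge_length {d : ℕ} {V : Finset (Fin d → ℤ)} (hV : V.Nonempty)
    {P : Set (Fin d → ℝ)} (hPV : P = convexHull ℝ (castVec '' (V : Set (Fin d → ℤ))))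
    (hP : ∀ c : Fin d → ℚ, (∀ i, Odd (c i).den) →
      latCount (ratVec c +ᵥ P) = latCount ((2 • ratVec c) +ᵥ P))
    {e : Fin d → ℤ} (he : e ≠ 0) :
    ∃ S : Finset (Fin d → ℝ), (∀ s ∈ S, s ∉ ℝ ∙ castVec e) ∧ ∃ ℓ : ℝ, 0 ≤ ℓ ∧
      ∀ φ : Fin d → ℝ, φ ⬝ᵥ castVec e = 0 → (∀ s ∈ S, φ ⬝ᵥ s ≠ 0) →
        ∃ p ∈ V, (∃ p' ∈ V, castVec p' = castVec p + ℓ • castVec e) ∧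
          (∀ v ∈ V, φ ⬝ᵥ castVec v ≤ φ ⬝ᵥ castVec p) ∧
          ∀ v ∈ V, φ ⬝ᵥ castVec v = φ ⬝ᵥ castVec p →
            ∃ s ∈ Set.Icc 0 ℓ, castVec v = castVec p + s • castVec e := by
  classical
  obtain ⟨A, hA⟩ := exists_integer_inequalities_convexHull V
  rw [← hPV] at hA
  have hPc : IsCompact P := hPV ▸ ((V.finite_toSet.image castVec).isCompact_convexHull ℝ)
  have hPconv : Convex ℝ P := hPV ▸ convex_convexHull ℝ _
  obtain ⟨δ, hδ, hδe, S₁, hS₁, M, hM⟩ :=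
    exists_ncard_maximalLatticePoints_eq hA hP hPc hPconv e
  set S₂ := ((V ×ˢ V).image fun q => castVec q.1 - castVec q.2).filter (· ∉ ℝ ∙ castVec e) with hS₂
  have key : ∀ φ : Fin d → ℝ, φ ⬝ᵥ castVec e = 0 → (∀ s ∈ S₁ ∪ S₂, φ ⬝ᵥ s ≠ 0) → ∃ ℓ : ℝ, 0 ≤ ℓ ∧
      (segmentLatticePoints e δ ℓ).ncard = M ∧ (∃ x, castVec x = ℓ • castVec e) ∧
        ∃ p ∈ V, (∃ p' ∈ V, castVec p' = castVec p + ℓ • castVec e) ∧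
          (∀ v ∈ V, φ ⬝ᵥ castVec v ≤ φ ⬝ᵥ castVec p) ∧
          ∀ v ∈ V, φ ⬝ᵥ castVec v = φ ⬝ᵥ castVec p →
            ∃ s ∈ Set.Icc 0 ℓ, castVec v = castVec p + s • castVec e := by
    intro φ hφe hφ
    obtain ⟨v₀, hv₀, hmax₀⟩ := V.exists_max_image (fun v => φ ⬝ᵥ castVec v) hV
    have hs : ∀ v : Fin d → ℤ, ∃ s : ℝ, v ∈ V → φ ⬝ᵥ castVec v = φ ⬝ᵥ castVec v₀ →
        castVec v = castVec v₀ + s • castVec e := by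
      intro v
      by_cases h : v ∈ V ∧ φ ⬝ᵥ castVec v = φ ⬝ᵥ castVec v₀
      · have hmem : castVec v - castVec v₀ ∈ ℝ ∙ castVec e := by
          by_contra hmem
          refine hφ (castVec v - castVec v₀) (Finset.mem_union_right _ (Finset.mem_filter.2
            ⟨Finset.mem_image.2 ⟨(v, v₀), Finset.mem_product.2 ⟨h.1, hv₀⟩, rfl⟩, hmem⟩)) ?_
          rw [dotProduct_sub, h.2, sub_self]
        obtain ⟨s, hs⟩ := Submodule.mem_span_singleton.1 hmem
        exact ⟨s, fun _ _ => by rw [hs, add_sub_cancel]⟩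
      · exact ⟨0, fun h1 h2 => absurd ⟨h1, h2⟩ h⟩
    choose s hs using hs
    set F := V.filter fun v => φ ⬝ᵥ castVec v = φ ⬝ᵥ castVec v₀ with hF
    have hFne : F.Nonempty := ⟨v₀, Finset.mem_filter.2 ⟨hv₀, rfl⟩⟩
    have hsF : ∀ v ∈ F, castVec v = castVec v₀ + s v • castVec e := fun v hv =>
      hs v (Finset.mem_filter.1 hv).1 (Finset.mem_filter.1 hv).2
    obtain ⟨p, hp, hpmin⟩ := F.exists_min_image s hFne
    obtain ⟨p', hp', hpmax⟩ := F.exists_max_image s hFne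
    have hpV := Finset.mem_filter.1 hp
    have hpp' : castVec p' = castVec p + (s p' - s p) • castVec e := by
      rw [hsF p hp, hsF p' hp', add_assoc, ← add_smul, add_sub_cancel]
    have hmax : ∀ v ∈ V, φ ⬝ᵥ castVec v ≤ φ ⬝ᵥ castVec p := fun v hv => by
      rw [hpV.2]; exact hmax₀ v hv
    have hseg : ∀ v ∈ V, φ ⬝ᵥ castVec v = φ ⬝ᵥ castVec p →
        ∃ t ∈ Set.Icc 0 (s p' - s p), castVec v = castVec p + t • castVec e := by
      intro v hv h
      have hvF : v ∈ F := Finset.mem_filter.2 ⟨hv, h.trans hpV.2⟩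
      refine ⟨s v - s p, ⟨sub_nonneg.2 (hpmin v hvF), sub_le_sub_right (hpmax v hvF) _⟩, ?_⟩
      rw [hsF p hp, hsF v hvF, add_assoc, ← add_smul, add_sub_cancel]
    refine ⟨s p' - s p, sub_nonneg.2 (hpmin p' hp'), ?_, ⟨p' - p, ?_⟩, p, hpV.1,
      ⟨p', (Finset.mem_filter.1 hp').1, hpp'⟩, hmax, hseg⟩
    · rw [← hM φ hφe fun s hs => hφ s (Finset.mem_union_left _ hs)]
      rw [← Set.ncard_image_of_injective _ (add_right_injective p)]
      congr 2
      have hmaxP : ∀ z ∈ P, φ ⬝ᵥ z < φ ⬝ᵥ castVec p ∨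
          ∃ t ∈ Set.Icc (0 : ℝ) (s p' - s p), z = castVec p + t • castVec e := by
        intro z hz
        rw [hPV] at hz
        refine exists_eq_add_smul_of_mem_convexHull hφe ?_ ?_ hz
        · rintro _ ⟨v, hv, rfl⟩
          exact hmax v hv
        · rintro _ ⟨v, hv, rfl⟩ h
          exact hseg v hv h
      have hVP : ∀ v ∈ V, castVec v ∈ P := fun v hv => by
        rw [hPV]; exact subset_convexHull ℝ _ ⟨v, hv, rfl⟩
      ext x
      constructor
      · rintro ⟨y, ⟨t, ht, hy⟩, rfl⟩
        have hx : castVec (p + y) - δ • castVec e = castVec p + t • castVec e := by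
          rw [castVec_add, hy, add_smul]
          abel
        have hφx : φ ⬝ᵥ (castVec p + t • castVec e) = φ ⬝ᵥ castVec p := by
          rw [dotProduct_add, dotProduct_smul, hφe, smul_zero, add_zero]
        refine ⟨?_, fun z hz => ?_⟩
        · simp only [hx]
          refine hPconv.segment_subset (hVP p hpV.1) (hVP p' (Finset.mem_filter.1 hp').1) ?_
          rw [segment_eq_image', hpp', add_sub_cancel_left]
          rcases (ht.1.trans ht.2).eq_or_lt with h0 | h0
          · refine ⟨0, ⟨le_rfl, zero_le_one⟩, ?_⟩
            have : t = 0 := le_antisymm (ht.2.trans h0.symm.le) ht.1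
            simp [this]
          · refine ⟨t / (s p' - s p), ⟨div_nonneg ht.1 h0.le, (div_le_one h0).2 ht.2⟩, ?_⟩
            simp only [smul_smul]
            rw [div_mul_cancel₀ _ h0.ne']
        · simp only [hx, hφx]
          rcases hmaxP z hz with h | ⟨t', -, rfl⟩
          · exact h.le
          · rw [dotProduct_add, dotProduct_smul, hφe, smul_zero, add_zero]
      · rintro ⟨hx, hxmax⟩
        rcases hmaxP _ hx with h | ⟨t, ht, hxt⟩
        · exact absurd (hxmax _ (hVP p hpV.1)) h.not_ge
        · refine ⟨x - p, ⟨t, ht, ?_⟩, add_sub_cancel _ _⟩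
          have h1 : castVec (x - p) + castVec p = castVec x := by
            rw [← castVec_add, sub_add_cancel]
          rw [sub_eq_iff_eq_add] at hxt
          rw [eq_sub_of_add_eq h1, hxt, add_smul]
          abel
    · have h1 : castVec (p' - p) + castVec p = castVec p' := by
        rw [← castVec_add, sub_add_cancel]
      rw [eq_sub_of_add_eq h1, hpp', add_sub_cancel_left]
  have huniq : ∀ {ℓ ℓ' : ℝ}, 0 ≤ ℓ → 0 ≤ ℓ' → ((segmentLatticePoints e δ ℓ).ncard : ℝ) = M →
      ((segmentLatticePoints e δ ℓ').ncard : ℝ) = M → (∃ x, castVec x = ℓ • castVec e) →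
      (∃ x, castVec x = ℓ' • castVec e) → ℓ = ℓ' := by
    rintro ℓ ℓ' h0 h0' h1 h1' ⟨x, hx⟩ ⟨x', hx'⟩
    have h2 : (segmentLatticePoints e δ ℓ).ncard = (segmentLatticePoints e δ ℓ').ncard := by
      exact_mod_cast h1.trans h1'.symm
    rcases lt_trichotomy ℓ ℓ' with h | h | h
    · exact absurd h2 (ncard_segmentLatticePoints_lt he hδ hδe h0 h hx hx').ne
    · exact h
    · exact absurd h2 (ncard_segmentLatticePoints_lt he hδ hδe h0' h hx' hx).ne'
  refine ⟨S₁ ∪ S₂, fun s hs => ?_, ?_⟩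
  · rcases Finset.mem_union.1 hs with hs | hs
    · exact hS₁ s hs
    · exact (Finset.mem_filter.1 hs).2
  · by_cases hex : ∃ φ : Fin d → ℝ, φ ⬝ᵥ castVec e = 0 ∧ ∀ s ∈ S₁ ∪ S₂, φ ⬝ᵥ s ≠ 0
    · obtain ⟨φ₀, hφ₀e, hφ₀⟩ := hex
      obtain ⟨ℓ, h0, hcard, hint, -⟩ := key φ₀ hφ₀e hφ₀
      refine ⟨ℓ, h0, fun φ hφe hφ => ?_⟩
      obtain ⟨ℓ', h0', hcard', hint', h⟩ := key φ hφe hφ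
      obtain rfl := huniq h0 h0' hcard hcard' hint hint'
      exact h
    · exact ⟨0, le_rfl, fun φ hφe hφ => absurd ⟨φ, hφe, hφ⟩ hex⟩

/-- Near `φ`, the function `f` agrees with a linear function. -/
def IsLocallyLinearAt {d : ℕ} (f : (Fin d → ℝ) → ℝ) (φ : Fin d → ℝ) : Prop :=
  ∃ x : Fin d → ℝ, ∀ᶠ ψ in nhds φ, f ψ = ψ ⬝ᵥ x

lemma IsLocallyLinearAt.sub {d : ℕ} {f g : (Fin d → ℝ) → ℝ} {φ : Fin d → ℝ}
    (hf : IsLocallyLinearAt f φ) (hg : IsLocallyLinearAt g φ) :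
    IsLocallyLinearAt (fun ψ => f ψ - g ψ) φ := by
  obtain ⟨x, hx⟩ := hf
  obtain ⟨y, hy⟩ := hg
  refine ⟨x - y, ?_⟩
  filter_upwards [hx, hy] with ψ h1 h2
  rw [h1, h2, dotProduct_sub]

lemma IsLocallyLinearAt.sum {d : ℕ} {ι : Type*} {s : Finset ι} {f : ι → (Fin d → ℝ) → ℝ}
    {φ : Fin d → ℝ} (hf : ∀ i ∈ s, IsLocallyLinearAt (f i) φ) :
    IsLocallyLinearAt (fun ψ => ∑ i ∈ s, f i ψ) φ := by
  have hx : ∀ i, ∃ x : Fin d → ℝ, i ∈ s → ∀ᶠ ψ in nhds φ, f i ψ = ψ ⬝ᵥ x := fun i => by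
    by_cases hi : i ∈ s
    · obtain ⟨x, hx⟩ := hf i hi
      exact ⟨x, fun _ => hx⟩
    · exact ⟨0, fun h => absurd h hi⟩
  choose x hx using hx
  refine ⟨∑ i ∈ s, x i, ?_⟩
  filter_upwards [(Filter.eventually_all_finset s).2 hx] with ψ h
  rw [dotProduct_sum]
  exact Finset.sum_congr rfl h

lemma continuous_dotProduct_left {d : ℕ} (v : Fin d → ℝ) :
    Continuous fun φ : Fin d → ℝ => φ ⬝ᵥ v :=
  Continuous.dotProduct continuous_id continuous_const

lemma isLocallyLinearAt_max_zero {d : ℕ} {φ e : Fin d → ℝ} {ℓ : ℝ} (hℓ : 0 ≤ ℓ) (h : φ ⬝ᵥ e ≠ 0) :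
    IsLocallyLinearAt (fun ψ => max 0 (ℓ * ψ ⬝ᵥ e)) φ := by
  have hcont := (continuous_dotProduct_left e).tendsto φ
  rcases h.lt_or_gt with h | h
  · refine ⟨0, ?_⟩
    filter_upwards [hcont.eventually_lt_const h] with ψ hψ
    rw [dotProduct_zero, max_eq_left (mul_nonpos_of_nonneg_of_nonpos hℓ hψ.le)]
  · refine ⟨ℓ • e, ?_⟩
    filter_upwards [hcont.eventually_const_lt h] with ψ hψ
    rw [dotProduct_smul, smul_eq_mul, max_eq_right (mul_nonneg hℓ hψ.le)]

lemma add_add_sub_eq_of_isLocallyLinearAt {d : ℕ} {f : (Fin d → ℝ) → ℝ} {φ₀ φ₁ : Fin d → ℝ}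
    (h : ∀ s : ℝ, IsLocallyLinearAt f (φ₀ + s • φ₁)) :
    f (φ₀ + φ₁) + f (φ₀ - φ₁) = 2 * f φ₀ := by
  set F : ℝ → ℝ := fun s => f (φ₀ + s • φ₁) with hF
  have hloc : ∀ s, ∃ x : Fin d → ℝ, ∀ᶠ t in nhds s, F t = φ₀ ⬝ᵥ x + t * φ₁ ⬝ᵥ x := by
    intro s
    obtain ⟨x, hx⟩ := h s
    have hcont : Filter.Tendsto (fun t : ℝ => φ₀ + t • φ₁) (nhds s) (nhds (φ₀ + s • φ₁)) :=
      Continuous.tendsto (by fun_prop) s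
    refine ⟨x, ?_⟩
    filter_upwards [hcont.eventually hx] with t ht
    exact ht.trans (by rw [add_dotProduct, smul_dotProduct, smul_eq_mul])
  have hderiv : ∀ s, ∃ c : ℝ, ∀ᶠ t in nhds s, HasDerivAt F c t := by
    intro s
    obtain ⟨x, hx⟩ := hloc s
    refine ⟨φ₁ ⬝ᵥ x, ?_⟩
    filter_upwards [hx.eventually_nhds] with t ht
    refine HasDerivAt.congr_of_eventuallyEq ?_ ht
    simpa using ((hasDerivAt_id t).mul_const (φ₁ ⬝ᵥ x)).const_add (φ₀ ⬝ᵥ x)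
  have hconst : IsLocallyConstant (deriv F) := by
    rw [IsLocallyConstant.iff_eventually_eq]
    intro s
    obtain ⟨c, hc⟩ := hderiv s
    filter_upwards [hc] with t ht
    rw [ht.deriv, hc.self_of_nhds.deriv]
  have hF' : ∀ s, HasDerivAt F (deriv F 0) s := by
    intro s
    obtain ⟨c, hc⟩ := hderiv s
    rw [hconst.apply_eq_of_preconnectedSpace 0 s]
    exact hc.self_of_nhds.differentiableAt.hasDerivAt
  have hG : ∀ s t, F s - s * deriv F 0 = F t - t * deriv F 0 := by
    have hd : ∀ s, HasDerivAt (fun s => F s - s * deriv F 0) 0 s := by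
      intro s
      have := (hF' s).sub ((hasDerivAt_id s).mul_const (deriv F 0))
      rwa [one_mul, sub_self] at this
    exact is_const_of_deriv_eq_zero (fun s => (hd s).differentiableAt) fun s => (hd s).deriv
  have h1 := hG 1 0
  have h2 := hG (-1) 0
  simp only [hF, one_smul, neg_smul, zero_smul, add_zero, ← sub_eq_add_neg] at h1 h2
  linarith

lemma LinearMap.exists_eq_dotProduct {d : ℕ} (f : (Fin d → ℝ) →ₗ[ℝ] ℝ) :
    ∃ x : Fin d → ℝ, ∀ φ, f φ = φ ⬝ᵥ x :=
  ⟨fun i => f fun j => if i = j then 1 else 0, fun φ => f.pi_apply_eq_sum_univ φ⟩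

lemma exists_eq_dotProduct_of_dense {d : ℕ} {g : (Fin d → ℝ) → ℝ} (hg : Continuous g)
    (hg0 : g 0 = 0) {D : Set (Fin d → ℝ)} (hD : Dense D)
    (h : ∀ y ∈ D, Dense {x | g (x + y) + g (x - y) = 2 * g x}) :
    ∃ x : Fin d → ℝ, ∀ φ, g φ = φ ⬝ᵥ x := by
  have h1 : ∀ y ∈ D, ∀ x, g (x + y) + g (x - y) = 2 * g x := fun y hy x =>
    congrFun (Continuous.ext_on (h y hy) (f := fun x => g (x + y) + g (x - y)) (by fun_prop)
      (g := fun x => 2 * g x) (by fun_prop) fun x hx => hx) x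
  have h2 : ∀ y x, g (x + y) + g (x - y) = 2 * g x := fun y x =>
    congrFun (Continuous.ext_on hD (f := fun y => g (x + y) + g (x - y)) (by fun_prop)
      (g := fun _ => 2 * g x) (by fun_prop) fun y hy => h1 y hy x) y
  have h3 : ∀ x, g ((2 : ℝ) • x) = 2 * g x := fun x => by
    have := h2 x x
    rwa [sub_self, hg0, add_zero, ← two_smul ℝ x] at this
  have hadd : ∀ x y, g (x + y) = g x + g y := fun x y => by
    have hx : (2⁻¹ : ℝ) • (x + y) + (2⁻¹ : ℝ) • (x - y) = x := by
      rw [← smul_add, add_add_sub_cancel, ← two_smul ℝ x, smul_smul]; norm_num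
    have hy : (2⁻¹ : ℝ) • (x + y) - (2⁻¹ : ℝ) • (x - y) = y := by
      rw [← smul_sub, add_sub_sub_cancel, ← two_smul ℝ y, smul_smul]; norm_num
    have := h2 ((2⁻¹ : ℝ) • (x - y)) ((2⁻¹ : ℝ) • (x + y))
    rw [hx, hy, ← h3, smul_smul] at this
    rw [this]
    norm_num
  obtain ⟨x, hx⟩ := LinearMap.exists_eq_dotProduct
    (AddMonoidHom.toRealLinearMap ⟨⟨g, hg0⟩, hadd⟩ hg : (Fin d → ℝ) →L[ℝ] ℝ).toLinearMap
  exact ⟨x, hx⟩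

lemma isLocallyLinearAt_sup'_sub_max_zero {d : ℕ} {V : Finset (Fin d → ℝ)} (hV : V.Nonempty)
    {p e φ : Fin d → ℝ} {ℓ : ℝ} (hp : p ∈ V) (hp' : p + ℓ • e ∈ V)
    (hmax : ∀ v ∈ V, φ ⬝ᵥ v ≤ φ ⬝ᵥ p)
    (hseg : ∀ v ∈ V, φ ⬝ᵥ v = φ ⬝ᵥ p → ∃ s ∈ Set.Icc (0 : ℝ) ℓ, v = p + s • e) :
    IsLocallyLinearAt (fun ψ => V.sup' hV (fun v => ψ ⬝ᵥ v) - max 0 (ℓ * ψ ⬝ᵥ e)) φ := by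
  have hev : ∀ᶠ ψ in nhds φ, ∀ v ∈ V, φ ⬝ᵥ v < φ ⬝ᵥ p → ψ ⬝ᵥ v < ψ ⬝ᵥ p := by
    rw [Filter.eventually_all_finset]
    intro v _
    by_cases h : φ ⬝ᵥ v < φ ⬝ᵥ p
    · filter_upwards [((continuous_dotProduct_left v).tendsto φ).eventually_lt
        ((continuous_dotProduct_left p).tendsto φ) h] with ψ hψ _ using hψ
    · exact Filter.Eventually.of_forall fun _ h' => absurd h' h
  refine ⟨p, ?_⟩
  filter_upwards [hev] with ψ hψ
  have hp'ψ : ψ ⬝ᵥ (p + ℓ • e) = ψ ⬝ᵥ p + ℓ * ψ ⬝ᵥ e := by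
    rw [dotProduct_add, dotProduct_smul, smul_eq_mul]
  rw [sub_eq_iff_eq_add]
  refine le_antisymm (Finset.sup'_le _ _ fun v hv => ?_) ?_
  · rcases (hmax v hv).lt_or_eq with h | h
    · exact (hψ v hv h).le.trans (le_add_of_nonneg_right (le_max_left _ _))
    · obtain ⟨s, hs, rfl⟩ := hseg v hv h
      rw [dotProduct_add, dotProduct_smul, smul_eq_mul]
      refine add_le_add_right ?_ _
      rcases le_total (ψ ⬝ᵥ e) 0 with h0 | h0
      · exact le_max_of_le_left (mul_nonpos_of_nonneg_of_nonpos hs.1 h0)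
      · exact le_max_of_le_right (mul_le_mul_of_nonneg_right hs.2 h0)
  · rw [← max_add_add_left, add_zero, ← hp'ψ]
    exact max_le (Finset.le_sup' (fun v => ψ ⬝ᵥ v) hp) (Finset.le_sup' (fun v => ψ ⬝ᵥ v) hp')

/-- If all edges of the convex hull of `V` in the same direction have the same length, then its
support function is that of a zonotope. -/
lemma exists_sup'_eq_dotProduct_add_sum {d : ℕ} {V : Finset (Fin d → ℝ)} (hV : V.Nonempty)
    {E : Finset (Fin d → ℝ)} (hE0 : ∀ e ∈ E, e ≠ 0)
    (hE : ∀ e ∈ E, ∀ e' ∈ E, e' ≠ e → e' ∉ ℝ ∙ e)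
    (hVE : ∀ v ∈ V, ∀ v' ∈ V, v ≠ v' → ∃ e ∈ E, ∃ c : ℝ, c ≠ 0 ∧ v - v' = c • e)
    {S : (Fin d → ℝ) → Finset (Fin d → ℝ)} (hS : ∀ e ∈ E, ∀ s ∈ S e, s ∉ ℝ ∙ e)
    {ℓ : (Fin d → ℝ) → ℝ} (hℓ : ∀ e ∈ E, 0 ≤ ℓ e)
    (hedge : ∀ e ∈ E, ∀ φ : Fin d → ℝ, φ ⬝ᵥ e = 0 → (∀ s ∈ S e, φ ⬝ᵥ s ≠ 0) →
      ∃ p ∈ V, p + ℓ e • e ∈ V ∧ (∀ v ∈ V, φ ⬝ᵥ v ≤ φ ⬝ᵥ p) ∧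
        ∀ v ∈ V, φ ⬝ᵥ v = φ ⬝ᵥ p → ∃ s ∈ Set.Icc 0 (ℓ e), v = p + s • e) :
    ∃ x : Fin d → ℝ, ∀ φ : Fin d → ℝ,
      V.sup' hV (fun v => φ ⬝ᵥ v) = φ ⬝ᵥ x + ∑ e ∈ E, max 0 (ℓ e * φ ⬝ᵥ e) := by
  classical
  set g : (Fin d → ℝ) → ℝ := fun φ =>
    V.sup' hV (fun v => φ ⬝ᵥ v) - ∑ e ∈ E, max 0 (ℓ e * φ ⬝ᵥ e) with hg
  suffices h : ∃ x : Fin d → ℝ, ∀ φ, g φ = φ ⬝ᵥ x by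
    obtain ⟨x, hx⟩ := h
    exact ⟨x, fun φ => by rw [← hx, hg]; exact (sub_add_cancel _ _).symm⟩
  have hgen : ∀ φ : Fin d → ℝ, (∀ e ∈ E, φ ⬝ᵥ e = 0 → (∀ s ∈ S e, φ ⬝ᵥ s ≠ 0) ∧
      ∀ e' ∈ E, e' ≠ e → φ ⬝ᵥ e' ≠ 0) → IsLocallyLinearAt g φ := by
    intro φ hφ
    by_cases hex : ∃ e ∈ E, φ ⬝ᵥ e = 0
    · obtain ⟨e, he, hφe⟩ := hex
      obtain ⟨hφS, hφE⟩ := hφ e he hφe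
      obtain ⟨p, hp, hp', hmax, hseg⟩ := hedge e he φ hφe hφS
      have h1 := isLocallyLinearAt_sup'_sub_max_zero hV hp hp' hmax hseg
      have h2 := h1.sub (IsLocallyLinearAt.sum (s := E.erase e)
        (f := fun e ψ => max 0 (ℓ e * ψ ⬝ᵥ e)) fun e' he' =>
        isLocallyLinearAt_max_zero (hℓ e' (Finset.mem_of_mem_erase he'))
          (hφE e' (Finset.mem_of_mem_erase he') (Finset.ne_of_mem_erase he')))
      convert h2 using 2 with ψ
      rw [hg, sub_sub]
      simp only
      rw [Finset.add_sum_erase E (fun e => max 0 (ℓ e * ψ ⬝ᵥ e)) he]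
    · push Not at hex
      obtain ⟨p, hp, hmax⟩ := V.exists_max_image (fun v => φ ⬝ᵥ v) hV
      have h1 := isLocallyLinearAt_sup'_sub_max_zero hV (e := 0) (ℓ := 0) hp (by simpa using hp)
        hmax fun v hv h => by
          refine ⟨0, ⟨le_rfl, le_rfl⟩, ?_⟩
          by_contra hne
          rw [smul_zero, add_zero] at hne
          obtain ⟨e, he, c, hc, hvp⟩ := hVE v hv p hp hne
          have : φ ⬝ᵥ (v - p) = 0 := by rw [dotProduct_sub, h, sub_self]
          rw [hvp, dotProduct_smul, smul_eq_mul] at this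
          exact mul_ne_zero hc (hex e he) this
      have h2 := h1.sub (IsLocallyLinearAt.sum (s := E)
        (f := fun e ψ => max 0 (ℓ e * ψ ⬝ᵥ e)) fun e he =>
        isLocallyLinearAt_max_zero (hℓ e he) (hex e he))
      simpa using h2
  refine exists_eq_dotProduct_of_dense (g := g) ?_ ?_ (dense_dotProduct_ne_zero E hE0) ?_
  · refine Continuous.sub ?_ (continuous_finsetSum _ fun e _ => ?_)
    · exact Continuous.finset_sup'_apply hV fun v _ => continuous_dotProduct_left v
    · exact continuous_const.max (continuous_const.mul (continuous_dotProduct_left e))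
  · simp [hg]
  · intro φ₁ hφ₁
    let T : Finset (Fin d → ℝ) := E.biUnion fun e =>
      (S e ∪ E.erase e).image fun v => (φ₁ ⬝ᵥ e) • v - (φ₁ ⬝ᵥ v) • e
    refine (dense_dotProduct_ne_zero T fun t ht => ?_).mono fun φ₀ hφ₀ => ?_
    · obtain ⟨e, he, ht⟩ := Finset.mem_biUnion.1 ht
      obtain ⟨v, hv, rfl⟩ := Finset.mem_image.1 ht
      have hve : v ∉ ℝ ∙ e := by
        rcases Finset.mem_union.1 hv with hv | hv
        · exact hS e he v hv
        · exact hE e he v (Finset.mem_of_mem_erase hv) (Finset.ne_of_mem_erase hv)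
      intro h0
      refine hve (Submodule.mem_span_singleton.2 ⟨(φ₁ ⬝ᵥ e)⁻¹ * φ₁ ⬝ᵥ v, ?_⟩)
      rw [mul_smul, ← sub_eq_zero.1 h0, inv_smul_smul₀ (hφ₁ e he)]
    · refine add_add_sub_eq_of_isLocallyLinearAt fun s => hgen _ fun e he h0 => ?_
      have key : ∀ v ∈ S e ∪ E.erase e, (φ₀ + s • φ₁) ⬝ᵥ v ≠ 0 := by
        intro v hv h1
        refine hφ₀ _ (Finset.mem_biUnion.2 ⟨e, he, Finset.mem_image_of_mem _ hv⟩) ?_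
        rw [add_dotProduct, smul_dotProduct, smul_eq_mul] at h0 h1
        rw [dotProduct_sub, dotProduct_smul, dotProduct_smul, smul_eq_mul, smul_eq_mul]
        linear_combination (φ₁ ⬝ᵥ e) * h1 - (φ₁ ⬝ᵥ v) * h0
      exact ⟨fun v hv => key v (Finset.mem_union_left _ hv),
        fun e' he' hne => key e' (Finset.mem_union_right _ (Finset.mem_erase.2 ⟨hne, he'⟩))⟩

lemma convex_zonotopeR {d n : ℕ} (u : Fin n → Fin d → ℝ) : Convex ℝ (zonotopeR u) := by
  rintro _ ⟨l, hl, rfl⟩ _ ⟨m, hm, rfl⟩ a b ha hb hab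
  refine ⟨a • l + b • m, fun i => convex_Icc 0 1 (hl i) (hm i) ha hb hab, ?_⟩
  simp only [Finset.smul_sum, smul_smul, ← Finset.sum_add_distrib, Pi.add_apply, Pi.smul_apply,
    smul_eq_mul, add_smul]

lemma isCompact_zonotopeR {d n : ℕ} (u : Fin n → Fin d → ℝ) : IsCompact (zonotopeR u) := by
  have : zonotopeR u = (fun l : Fin n → ℝ => ∑ i, l i • u i) '' Set.Icc 0 1 := by
    ext x
    constructor
    · rintro ⟨l, hl, rfl⟩
      exact ⟨l, ⟨fun i => (hl i).1, fun i => (hl i).2⟩, rfl⟩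
    · rintro ⟨l, hl, rfl⟩
      exact ⟨l, fun i => ⟨hl.1 i, hl.2 i⟩, rfl⟩
  rw [this]
  exact isCompact_Icc.image (by fun_prop)

/-- A polytope whose support function is that of a zonotope is a zonotope. -/
lemma isZonotope_convexHull_of_sup'_eq {d : ℕ} {V : Finset (Fin d → ℝ)} (hV : V.Nonempty)
    {n : ℕ} (u : Fin n → Fin d → ℝ) (x : Fin d → ℝ)
    (h : ∀ φ : Fin d → ℝ, V.sup' hV (fun v => φ ⬝ᵥ v) = φ ⬝ᵥ x + ∑ i, max 0 (φ ⬝ᵥ u i)) :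
    IsZonotope (convexHull ℝ (V : Set (Fin d → ℝ))) := by
  refine ⟨n, u, x, Set.Subset.antisymm (convexHull_min (fun v hv => ?_)
    ((convex_zonotopeR u).vadd x)) fun z hz => ?_⟩
  · by_contra hvZ
    obtain ⟨f, r, hf, hr⟩ := geometric_hahn_banach_closed_point ((convex_zonotopeR u).vadd x)
      ((isCompact_zonotopeR u).vadd x).isClosed hvZ
    obtain ⟨φ, hφ⟩ := LinearMap.exists_eq_dotProduct f.toLinearMap
    have hfφ : ∀ y, f y = φ ⬝ᵥ y := fun y => (hφ y).trans (dotProduct_comm _ _)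
    have h1 : φ ⬝ᵥ v ≤ _ := Finset.le_sup' (fun v => φ ⬝ᵥ v) hv
    rw [h] at h1
    have h2 := hf (x + ∑ i, (if 0 ≤ φ ⬝ᵥ u i then (1 : ℝ) else 0) • u i)
      (Set.vadd_mem_vadd_set ⟨_, fun i => by split_ifs <;> simp, rfl⟩)
    have h3 : φ ⬝ᵥ ∑ i, (if 0 ≤ φ ⬝ᵥ u i then (1 : ℝ) else 0) • u i = ∑ i, max 0 (φ ⬝ᵥ u i) := by
      rw [dotProduct_sum]
      refine Finset.sum_congr rfl fun i _ => ?_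
      split_ifs with h0
      · rw [one_smul, max_eq_right h0]
      · rw [zero_smul, dotProduct_zero, max_eq_left (not_le.1 h0).le]
    rw [hfφ, dotProduct_add, h3] at h2
    rw [hfφ] at hr
    linarith
  · by_contra hzP
    obtain ⟨f, r, hf, hr⟩ := geometric_hahn_banach_closed_point (convex_convexHull ℝ _)
      (V.finite_toSet.isCompact_convexHull ℝ).isClosed hzP
    obtain ⟨φ, hφ⟩ := LinearMap.exists_eq_dotProduct f.toLinearMap
    have hfφ : ∀ y, f y = φ ⬝ᵥ y := fun y => (hφ y).trans (dotProduct_comm _ _)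
    obtain ⟨v, hv, hmax⟩ := V.exists_mem_eq_sup' hV (fun v => φ ⬝ᵥ v)
    have h1 := hf v (subset_convexHull ℝ _ hv)
    obtain ⟨_, ⟨l, hl, rfl⟩, rfl⟩ := hz
    simp only [vadd_eq_add] at hr
    rw [hfφ, dotProduct_add, dotProduct_sum] at hr
    rw [hfφ, ← hmax, h] at h1
    have h2 : ∑ i, φ ⬝ᵥ (l i • u i) ≤ ∑ i, max 0 (φ ⬝ᵥ u i) := by
      refine Finset.sum_le_sum fun i _ => ?_
      rw [dotProduct_smul, smul_eq_mul]
      rcases le_total (φ ⬝ᵥ u i) 0 with h0 | h0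
      · exact le_max_of_le_left (mul_nonpos_of_nonneg_of_nonpos (hl i).1 h0)
      · exact le_max_of_le_right (mul_le_of_le_one_left h0 (hl i).2)
    linarith

/-- A finite set of nonzero vectors contains a set of representatives up to proportionality. -/
lemma exists_subset_representatives {d : ℕ} (D : Finset (Fin d → ℝ)) (hD : ∀ v ∈ D, v ≠ 0) :
    ∃ E ⊆ D, (∀ e ∈ E, ∀ e' ∈ E, e' ≠ e → e' ∉ ℝ ∙ e) ∧
      ∀ v ∈ D, ∃ e ∈ E, ∃ c : ℝ, c ≠ 0 ∧ v = c • e := by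
  classical
  obtain ⟨E, hED, hinj, himg⟩ := Finset.exists_subset_injOn_image_eq_of_surjOn (D : Set (Fin d → ℝ))
    (D.image fun v => ℝ ∙ v) (f := fun v => ℝ ∙ v) fun W hW => by simpa using hW
  refine ⟨E, by exact_mod_cast hED, fun e he e' he' hne hmem => hne ?_, fun v hv => ?_⟩
  · refine hinj he' he ?_
    obtain ⟨c, rfl⟩ := Submodule.mem_span_singleton.1 hmem
    have hc : c ≠ 0 := by
      rintro rfl
      exact hD _ (hED he') (zero_smul _ _)
    exact Submodule.span_singleton_smul_eq (IsUnit.mk0 c hc) e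
  · have : (ℝ ∙ v) ∈ E.image fun v => ℝ ∙ v := by
      rw [himg]
      exact Finset.mem_image_of_mem _ hv
    obtain ⟨e, he, hev⟩ := Finset.mem_image.1 this
    have hmem : v ∈ ℝ ∙ e := by
      rw [hev]
      exact Submodule.mem_span_singleton_self v
    obtain ⟨c, rfl⟩ := Submodule.mem_span_singleton.1 hmem
    refine ⟨e, he, c, ?_, rfl⟩
    rintro rfl
    exact hD _ hv (zero_smul _ _)

/-- A lattice polytope is a zonotope if the number of lattice points of its translates by vectors
with odd denominators is invariant under doubling the translation vector. -/
lemma isZonotope_of_latCount_eq {d : ℕ} {P : Set (Fin d → ℝ)} (hP : IsLatticePolytope P)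
    (h : ∀ c : Fin d → ℚ, (∀ i, Odd (c i).den) →
      latCount (ratVec c +ᵥ P) = latCount ((2 • ratVec c) +ᵥ P)) :
    IsZonotope P := by
  classical
  obtain ⟨V, hV, hPV⟩ := hP
  have hint : ∀ e : Fin d → ℝ, ∃ S : Finset (Fin d → ℝ), ∃ ℓ : ℝ,
      e ≠ 0 → (∃ z, castVec z = e) → (∀ s ∈ S, s ∉ ℝ ∙ e) ∧ 0 ≤ ℓ ∧
        ∀ φ : Fin d → ℝ, φ ⬝ᵥ e = 0 → (∀ s ∈ S, φ ⬝ᵥ s ≠ 0) →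
          ∃ p ∈ V.image castVec, p + ℓ • e ∈ V.image castVec ∧
            (∀ v ∈ V.image castVec, φ ⬝ᵥ v ≤ φ ⬝ᵥ p) ∧
            ∀ v ∈ V.image castVec, φ ⬝ᵥ v = φ ⬝ᵥ p → ∃ s ∈ Set.Icc 0 ℓ, v = p + s • e := by
    intro e
    by_cases he : e ≠ 0 ∧ ∃ z, castVec z = e
    · obtain ⟨he, z, rfl⟩ := he
      obtain ⟨S, hS, ℓ, hℓ, hedge⟩ := exists_edge_length hV hPV h (e := z) <| by
        rintro rfl
        exact he (funext fun _ => Int.cast_zero)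
      refine ⟨S, ℓ, fun _ _ => ⟨hS, hℓ, fun φ hφ hφS => ?_⟩⟩
      obtain ⟨p, hp, ⟨p', hp', hpp'⟩, hmax, hseg⟩ := hedge φ hφ hφS
      simp only [Finset.forall_mem_image]
      exact ⟨_, Finset.mem_image_of_mem _ hp, hpp' ▸ Finset.mem_image_of_mem _ hp', @hmax, @hseg⟩
    · exact ⟨∅, 0, fun h1 h2 => absurd ⟨h1, h2⟩ he⟩
  choose S ℓ hSℓ using hint
  obtain ⟨E, hED, hE, hDE⟩ := exists_subset_representatives
    (((V ×ˢ V).image fun q => castVec q.1 - castVec q.2).filter (· ≠ 0))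
    fun v hv => (Finset.mem_filter.1 hv).2
  have hE0 : ∀ e ∈ E, e ≠ 0 := fun e he => (Finset.mem_filter.1 (hED he)).2
  have hEint : ∀ e ∈ E, ∃ z, castVec z = e := fun e he => by
    obtain ⟨q, -, rfl⟩ := Finset.mem_image.1 (Finset.mem_filter.1 (hED he)).1
    exact ⟨q.1 - q.2, funext fun i => Int.cast_sub _ _⟩
  obtain ⟨x, hx⟩ := exists_sup'_eq_dotProduct_add_sum (hV.image castVec) hE0 hE
    (fun v hv v' hv' hne => by
      obtain ⟨z, hz, rfl⟩ := Finset.mem_image.1 hv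
      obtain ⟨z', hz', rfl⟩ := Finset.mem_image.1 hv'
      exact hDE _ (Finset.mem_filter.2 ⟨Finset.mem_image.2 ⟨(z, z'),
        Finset.mem_product.2 ⟨hz, hz'⟩, rfl⟩, sub_ne_zero.2 hne⟩))
    (fun e he => (hSℓ e (hE0 e he) (hEint e he)).1)
    (fun e he => (hSℓ e (hE0 e he) (hEint e he)).2.1)
    (fun e he => (hSℓ e (hE0 e he) (hEint e he)).2.2)
  rw [hPV, ← Finset.coe_image]
  refine isZonotope_convexHull_of_sup'_eq (hV.image castVec)
    (fun i : Fin E.card => ℓ (E.equivFin.symm i) • (E.equivFin.symm i : Fin d → ℝ)) x fun φ => ?_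
  rw [hx, ← E.sum_coe_sort fun e => max 0 (ℓ e * φ ⬝ᵥ e)]
  congr 1
  refine Fintype.sum_equiv E.equivFin _ _ fun e => ?_
  rw [Equiv.symm_apply_apply, dotProduct_smul, smul_eq_mul]

/-- If a lattice polytope `P` is not a zonotope, then there is `c ∈ ℚ^d`
all of whose coordinates have odd denominators with `L_{(P,c)} ≠ L_{(P,2c)}`. -/
theorem exists_odd_denominator_vector_of_not_zonotope
    (d : ℕ) (P : Set (Fin d → ℝ)) (hP : IsLatticePolytope P)
    (hz : ¬ IsZonotope P) :
    ∃ c : Fin d → ℚ, (∀ i, Odd (c i).den) ∧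
      ∃ t : ℕ, 0 < t ∧
        latCount (ratVec c +ᵥ (t : ℝ) • P) ≠
          latCount ((2 • ratVec c) +ᵥ (t : ℝ) • P) := by
  by_contra! hcon
  refine hz (isZonotope_of_latCount_eq hP fun c hc => ?_)
  have := hcon c hc 1 one_pos
  rwa [Nat.cast_one, one_smul] at this
end
end

section
/- Let P ⊂ ℝ^d be a lattice zonotope and c ∈ ℚ^d. Then the minimal period of the Ehrhart quasi-polynomial L_{c+P}(t) = #(t(c+P) ∩ ℤ^d) is exactly den(c). -/
open Pointwise MeasureTheory
open scoped RealInnerProductSpace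

noncomputable section

/-- The points `v + ∑ i, lam i • w i` with all coefficients in `[0, t]`: the translate by `v`
of the `t`-fold dilate of the zonotope spanned by `w`. -/
def dilatedZonotope {V : Type} [AddCommGroup V] [Module ℝ V] {n : ℕ} (v : V) (w : Fin n → V)
    (t : ℝ) : Set V :=
  {y | ∃ lam : Fin n → ℝ, (∀ i, lam i ∈ Set.Icc 0 t) ∧ y = v + ∑ i, lam i • w i}

section DilatedZonotope

variable {V : Type} [AddCommGroup V] [Module ℝ V] {n : ℕ}

theorem convex_dilatedZonotope (v : V) (w : Fin n → V) (t : ℝ) :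
    Convex ℝ (dilatedZonotope v w t) := by
  rintro _ ⟨l, hl, rfl⟩ _ ⟨m, hm, rfl⟩ a b ha hb hab
  refine ⟨fun i => a • l i + b • m i, fun i => convex_Icc 0 t (hl i) (hm i) ha hb hab, ?_⟩
  simp only [smul_add, Finset.smul_sum, add_smul, Finset.sum_add_distrib, smul_assoc]
  rw [add_add_add_comm, ← add_smul, hab, one_smul]

theorem dilatedZonotope_mono (v : V) (w : Fin n → V) {s t : ℝ} (h : s ≤ t) :
    dilatedZonotope v w s ⊆ dilatedZonotope v w t := by
  rintro _ ⟨l, hl, rfl⟩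
  exact ⟨l, fun i => ⟨(hl i).1, (hl i).2.trans h⟩, rfl⟩

theorem mem_dilatedZonotope_succ (v : V) (w : Fin (n + 1) → V) (t : ℝ) (y : V) :
    y ∈ dilatedZonotope v w t ↔
      ∃ r ∈ Set.Icc 0 t, y - r • w 0 ∈ dilatedZonotope v (fun i => w i.succ) t := by
  constructor
  · rintro ⟨l, hl, rfl⟩
    refine ⟨l 0, hl 0, fun i => l i.succ, fun i => hl _, ?_⟩
    rw [Fin.sum_univ_succ]
    abel
  · rintro ⟨r, hr, l, hl, h⟩
    refine ⟨Fin.cons r l, fun i => Fin.cases hr hl i, ?_⟩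
    rw [Fin.sum_univ_succ]
    simp only [Fin.cons_zero, Fin.cons_succ]
    rw [← sub_add_cancel y (r • w 0), h]
    abel

theorem mem_dilatedZonotope_mkQ (v a : V) (w : Fin n → V) (t : ℝ) (y : V) :
    (ℝ ∙ a).mkQ y ∈ dilatedZonotope ((ℝ ∙ a).mkQ v) (fun i => (ℝ ∙ a).mkQ (w i)) t ↔
      ∃ r : ℝ, y - r • a ∈ dilatedZonotope v w t := by
  have key (l : Fin n → ℝ) : (ℝ ∙ a).mkQ y = (ℝ ∙ a).mkQ v + ∑ i, l i • (ℝ ∙ a).mkQ (w i) ↔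
      ∃ r : ℝ, y - r • a = v + ∑ i, l i • w i := by
    simp only [← map_smul, ← map_sum, ← map_add]
    rw [Submodule.mkQ_apply, Submodule.mkQ_apply, Submodule.Quotient.eq,
      Submodule.mem_span_singleton]
    refine exists_congr fun r => ?_
    rw [eq_comm, sub_eq_iff_eq_add, sub_eq_iff_eq_add, add_comm]
  constructor
  · rintro ⟨l, hl, h⟩
    obtain ⟨r, hr⟩ := (key l).1 h
    exact ⟨r, l, hl, hr⟩
  · rintro ⟨r, l, hl, h⟩
    exact ⟨l, hl, (key l).2 ⟨r, h⟩⟩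

end DilatedZonotope

section Counting

variable {G V : Type} [AddCommGroup G] [AddCommGroup V] [Module ℝ V]

theorem Convex.sub_smul_mem_of_le_of_le {B : Set V} (hB : Convex ℝ B) {y a : V} {r s t : ℝ}
    (hr : y - r • a ∈ B) (ht : y - t • a ∈ B) (hrs : r ≤ s) (hst : s ≤ t) :
    y - s • a ∈ B := by
  have hI : Convex ℝ {s : ℝ | y - s • a ∈ B} := by
    intro p hp q hq α β hα hβ hαβ
    have := hB hp hq hα hβ hαβ
    rw [Set.mem_ofPred_eq]
    convert this using 1
    simp only [smul_eq_mul]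
    have hy : y = (α + β) • y := by rw [hαβ, one_smul]
    nth_rewrite 1 [hy]
    module
  exact hI.ordConnected.out hr ht ⟨hrs, hst⟩

/-- Sweeping a convex set `B` along `m` copies of the lattice vector `u` adds, for each line in
direction `u` through a lattice point which meets `B`, exactly `m` points of each coset of `ℤ u`
on that line. -/
theorem ncard_sweep (φ : G →+ V) (u : G) (hu : φ u ≠ 0) {B : Set V} (hB : Convex ℝ B)
    (hfin : ∀ m : ℕ, {x : G | ∃ r ∈ Set.Icc (0 : ℝ) m, φ x - r • φ u ∈ B}.Finite) (m : ℕ) :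
    {x : G | ∃ r ∈ Set.Icc (0 : ℝ) m, φ x - r • φ u ∈ B}.ncard = {x : G | φ x ∈ B}.ncard +
      m * ((fun x : G => (x : G ⧸ AddSubgroup.zmultiples u)) ''
        {x : G | ∃ r : ℝ, φ x - r • φ u ∈ B}).ncard := by
  classical
  set S : Set G := {x | φ x ∈ B}
  set T : Set G := {x | ∃ r ∈ Set.Icc (0 : ℝ) m, φ x - r • φ u ∈ B} with hT
  have hmemS (x : G) : x ∈ S ↔ φ x ∈ B := Iff.rfl
  set Q : Set (G ⧸ AddSubgroup.zmultiples u) :=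
    (fun x : G => (x : G ⧸ AddSubgroup.zmultiples u)) '' {x : G | ∃ r : ℝ, φ x - r • φ u ∈ B}
    with hQ
  have hφ (x : G) (z : ℤ) (r : ℝ) : φ (x + z • u) - r • φ u = φ x - (r - z) • φ u := by
    rw [map_add, map_zsmul, ← Int.cast_smul_eq_zsmul ℝ]
    module
  have hrep : ∀ q ∈ Q, ∃ x : G, (x : G ⧸ AddSubgroup.zmultiples u) = q ∧
      ∃ r : ℝ, 0 ≤ r ∧ r ≤ 1 ∧ φ x - r • φ u ∈ B := by
    rintro _ ⟨x, ⟨r, hr⟩, rfl⟩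
    refine ⟨x + (-⌊r⌋) • u, ?_, Int.fract r, Int.fract_nonneg r, (Int.fract_lt_one r).le, ?_⟩
    · rw [QuotientAddGroup.eq]
      exact ⟨⌊r⌋, by simp⟩
    · rw [hφ]
      convert hr using 3
      push_cast
      rw [sub_neg_eq_add, Int.fract_add_floor]
  choose! e he hr using hrep
  have hmk (x : G) (z : ℤ) : ((x + z • u : G) : G ⧸ AddSubgroup.zmultiples u) = x := by
    rw [QuotientAddGroup.eq]
    exact ⟨-z, by simp⟩
  have hinj : ∀ q ∈ Q, ∀ q' ∈ Q, ∀ z z' : ℤ, e q + z • u = e q' + z' • u → q = q' ∧ z = z' := by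
    intro q hq q' hq' z z' h
    have hqq : q = q' := by
      rw [← he q hq, ← he q' hq', ← hmk (e q) z, h, hmk]
    subst hqq
    refine ⟨rfl, ?_⟩
    have h1 := congrArg φ (add_left_cancel h)
    rw [map_zsmul, map_zsmul, ← Int.cast_smul_eq_zsmul ℝ, ← Int.cast_smul_eq_zsmul ℝ] at h1
    exact_mod_cast smul_left_injective ℝ hu h1
  have hdec : ∀ x : G, (∃ r : ℝ, φ x - r • φ u ∈ B) → ∃ q ∈ Q, ∃ z : ℤ, x = e q + z • u := by
    intro x hx
    refine ⟨x, ⟨x, hx, rfl⟩, ?_⟩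
    have := he x ⟨x, hx, rfl⟩
    rw [QuotientAddGroup.eq] at this
    obtain ⟨z, hz⟩ := this
    exact ⟨z, by rw [show z • u = _ from hz]; abel⟩
  have hSfin : S.Finite := (hfin 0).subset fun x hx => ⟨0, by simp, by simpa using (hmemS x).1 hx⟩
  have hQfin : Q.Finite := by
    refine ((hfin 1).image (fun x : G => (x : G ⧸ AddSubgroup.zmultiples u))).subset ?_
    intro q hq
    obtain ⟨r, h0, h1, h⟩ := hr q hq
    exact ⟨e q, ⟨r, ⟨h0, by simpa using h1⟩, h⟩, he q hq⟩
  set N : Set G := {x ∈ S | ∃ q ∈ Q, ∃ z : ℤ, z < 0 ∧ x = e q + z • u} with hN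
  set M : Set G := {x ∈ S | ∃ q ∈ Q, ∃ z : ℤ, 0 ≤ z ∧ x = e q + z • u} with hM
  set F : Set G := (fun p : (G ⧸ AddSubgroup.zmultiples u) × ℤ => e p.1 + p.2 • u) ''
    (Q ×ˢ Set.Ico (0 : ℤ) m) with hF
  have hSU : S = N ∪ M := by
    ext x
    constructor
    · intro hx
      obtain ⟨q, hq, z, rfl⟩ := hdec x ⟨0, by simpa using (hmemS x).1 hx⟩
      rcases lt_or_ge z 0 with hz | hz
      · exact Or.inl ⟨hx, q, hq, z, hz, rfl⟩
      · exact Or.inr ⟨hx, q, hq, z, hz, rfl⟩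
    · rintro (hx | hx) <;> exact hx.1
  have hNM : Disjoint N M := by
    rw [Set.disjoint_left]
    rintro _ ⟨-, q, hq, z, hz, rfl⟩ ⟨-, q', hq', z', hz', h⟩
    have := (hinj _ hq _ hq' _ _ h).2
    omega
  have hNfin : N.Finite := hSfin.subset fun x hx => hx.1
  have hMfin : M.Finite := hSfin.subset fun x hx => hx.1
  have hTU : T = N ∪ ((fun x => x + (m : ℤ) • u) '' M ∪ F) := by
    ext x
    constructor
    · rintro ⟨r, hr0, hrB⟩
      obtain ⟨q, hq, z, rfl⟩ := hdec x ⟨r, hrB⟩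
      obtain ⟨s, hs0, hs1, hs⟩ := hr q hq
      rw [hφ] at hrB
      rcases lt_or_ge z 0 with hz | hz
      · refine Or.inl ⟨?_, q, hq, z, hz, rfl⟩
        have hz' : (z : ℝ) ≤ -1 := by exact_mod_cast (by omega : z ≤ -1)
        have := hB.sub_smul_mem_of_le_of_le (s := 0 - (z : ℝ)) hs hrB (by linarith)
          (by linarith [hr0.1])
        rw [← hφ] at this
        simpa [hmemS] using this
      · refine Or.inr ?_
        rcases lt_or_ge z m with hzm | hzm
        · exact Or.inr ⟨(q, z), ⟨hq, hz, hzm⟩, rfl⟩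
        · refine Or.inl ⟨e q + (z - m) • u, ⟨?_, q, hq, z - m, by omega, rfl⟩, ?_⟩
          · have hz' : (m : ℝ) ≤ z := by exact_mod_cast hzm
            have := hB.sub_smul_mem_of_le_of_le (s := 0 - ((z - m : ℤ) : ℝ)) hrB hs
              (by push_cast; linarith [hr0.2]) (by push_cast; linarith)
            rw [← hφ] at this
            simpa only [hmemS, zero_smul, sub_zero] using this
          · simp only
            rw [add_assoc, ← add_smul, sub_add_cancel]
    · rintro (hx | ⟨x, hx, rfl⟩ | ⟨⟨q, z⟩, ⟨hq, hz0, hzm⟩, rfl⟩)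
      · exact ⟨0, by simp, by simpa using (hmemS x).1 hx.1⟩
      · refine ⟨m, by simp, ?_⟩
        rw [hφ]
        simpa using (hmemS x).1 hx.1
      · obtain ⟨s, hs0, hs1, hs⟩ := hr q hq
        have h0 : (0 : ℝ) ≤ z := by exact_mod_cast hz0
        have h1 : (z : ℝ) + 1 ≤ m := by exact_mod_cast hzm
        refine ⟨z + s, ⟨by linarith, by linarith⟩, ?_⟩
        simp only
        rw [hφ]
        simpa using hs
  have hMF : Disjoint ((fun x => x + (m : ℤ) • u) '' M) F := by
    rw [Set.disjoint_left]
    rintro _ ⟨_, ⟨-, q, hq, z, hz, rfl⟩, rfl⟩ ⟨⟨q', z'⟩, ⟨hq', hz0, hzm⟩, h⟩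
    simp only at h
    rw [add_assoc, ← add_smul] at h
    have := (hinj _ hq' _ hq _ _ h).2
    simp only at hzm
    omega
  have hNMF : Disjoint N ((fun x => x + (m : ℤ) • u) '' M ∪ F) := by
    rw [Set.disjoint_left]
    rintro _ ⟨-, q, hq, z, hz, rfl⟩ (⟨_, ⟨-, q', hq', z', hz', rfl⟩, h⟩ |
      ⟨⟨q', z'⟩, ⟨hq', hz0, hzm⟩, h⟩)
    · simp only at h
      rw [add_assoc, ← add_smul] at h
      have := (hinj _ hq' _ hq _ _ h).2
      omega
    · have := (hinj _ hq' _ hq _ _ h).2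
      simp only at hz0 this
      omega
  have hFfin : F.Finite := (hQfin.prod (Set.finite_Ico _ _)).image _
  have hFcard : F.ncard = m * Q.ncard := by
    rw [hF, Set.InjOn.ncard_image, Set.ncard_prod, mul_comm]
    · simp [Set.ncard_eq_toFinset_card']
    · rintro ⟨q, z⟩ ⟨hq, -⟩ ⟨q', z'⟩ ⟨hq', -⟩ h
      exact Prod.ext_iff.2 (hinj _ hq _ hq' _ _ h)
  rw [hTU, Set.ncard_union_eq hNMF hNfin ((hMfin.image _).union hFfin),
    Set.ncard_union_eq hMF (hMfin.image _) hFfin,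
    Set.ncard_image_of_injective _ (add_left_injective _), hFcard, hSU,
    Set.ncard_union_eq hNM hNfin hMfin, add_assoc]

/-- The number of lattice points in a translate of the `t`-th dilate of a lattice zonotope is a
polynomial in `t : ℕ`. The lattice is allowed to have torsion so that it can be replaced by its
quotient by a generator of the zonotope. -/
theorem exists_polynomial_ncard_dilatedZonotope (n : ℕ) :
    ∀ (G V : Type) [AddCommGroup G] [AddCommGroup V] [Module ℝ V] (φ : G →+ V) (v : V)
      (u : Fin n → G),
      (∀ t : ℕ, {x : G | φ x ∈ dilatedZonotope v (fun i => φ (u i)) t}.Finite) →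
      ∃ p : Polynomial ℚ, ∀ t : ℕ,
        ({x : G | φ x ∈ dilatedZonotope v (fun i => φ (u i)) t}.ncard : ℚ) = p.eval (t : ℚ) := by
  induction n with
  | zero =>
    intro G V _ _ _ φ v u _
    refine ⟨Polynomial.C ({x : G | φ x = v}.ncard : ℚ), fun t => ?_⟩
    simp [dilatedZonotope]
  | succ n ih =>
    intro G V _ _ _ φ v u hfin
    have hfin_tail (t : ℕ) :
        {x : G | φ x ∈ dilatedZonotope v (fun i : Fin n => φ (u i.succ)) t}.Finite :=
      (hfin t).subset fun x hx =>
        (mem_dilatedZonotope_succ _ _ _ _).2 ⟨0, by simp, by simpa using hx⟩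
    obtain ⟨p, hp⟩ := ih G V φ v (fun i => u i.succ) hfin_tail
    by_cases hu : φ (u 0) = 0
    · refine ⟨p, fun t => ?_⟩
      rw [← hp]
      congr 2
      ext x
      simp only [Set.mem_ofPred_eq, mem_dilatedZonotope_succ v (fun i => φ (u i)), hu, smul_zero,
        sub_zero]
      exact ⟨fun ⟨_, _, h⟩ => h, fun h => ⟨0, by simp, h⟩⟩
    · let ψ : G ⧸ AddSubgroup.zmultiples (u 0) →+ V ⧸ (ℝ ∙ φ (u 0)) :=
        QuotientAddGroup.lift _ ((ℝ ∙ φ (u 0)).mkQ.toAddMonoidHom.comp φ) (by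
          rintro _ ⟨z, rfl⟩
          have : φ (u 0) ∈ (ℝ ∙ φ (u 0)) := Submodule.mem_span_singleton_self _
          refine (Submodule.Quotient.mk_eq_zero _).2 ?_
          exact (map_zsmul φ z (u 0)).symm ▸ zsmul_mem this z)
      have hψ (x : G) : ψ x = (ℝ ∙ φ (u 0)).mkQ (φ x) := rfl
      have hmem (t : ℕ) (x : G) : ψ x ∈ dilatedZonotope ((ℝ ∙ φ (u 0)).mkQ v)
          (fun i : Fin n => ψ (u i.succ)) t ↔ ∃ r : ℝ,
            φ x - r • φ (u 0) ∈ dilatedZonotope v (fun i : Fin n => φ (u i.succ)) t := by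
        simp only [hψ]
        exact mem_dilatedZonotope_mkQ v (φ (u 0)) (fun i : Fin n => φ (u i.succ)) t (φ x)
      have himage (t : ℕ) : {q | ψ q ∈ dilatedZonotope ((ℝ ∙ φ (u 0)).mkQ v)
          (fun i : Fin n => ψ (u i.succ)) t} =
          (fun x : G => (x : G ⧸ AddSubgroup.zmultiples (u 0))) '' {x : G | ∃ r : ℝ,
            φ x - r • φ (u 0) ∈ dilatedZonotope v (fun i : Fin n => φ (u i.succ)) t} := by
        ext q
        constructor
        · induction q using QuotientAddGroup.induction_on with
          | H x => exact fun hq => ⟨x, (hmem t x).1 hq, rfl⟩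
        · rintro ⟨x, hx, rfl⟩
          exact (hmem t x).2 hx
      have hsweep (t m : ℕ) : {x : G | ∃ r ∈ Set.Icc (0 : ℝ) m,
          φ x - r • φ (u 0) ∈ dilatedZonotope v (fun i : Fin n => φ (u i.succ)) t}.Finite := by
        refine (hfin (t + m)).subset ?_
        rintro x ⟨r, hr, hx⟩
        refine (mem_dilatedZonotope_succ _ _ _ _).2 ⟨r, ⟨hr.1, ?_⟩,
          dilatedZonotope_mono _ _ ?_ hx⟩
        · push_cast
          linarith [hr.2, Nat.cast_nonneg (α := ℝ) t]
        · push_cast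
          linarith [Nat.cast_nonneg (α := ℝ) m]
      obtain ⟨p', hp'⟩ := ih _ _ ψ ((ℝ ∙ φ (u 0)).mkQ v)
        (fun i => (u i.succ : G ⧸ AddSubgroup.zmultiples (u 0))) (by
          intro t
          rw [himage]
          refine ((hsweep t 1).image
            (fun x : G => (x : G ⧸ AddSubgroup.zmultiples (u 0)))).subset ?_
          rintro _ ⟨x, ⟨r, hx⟩, rfl⟩
          refine ⟨x + (-⌊r⌋) • u 0, ⟨Int.fract r, ⟨Int.fract_nonneg r, ?_⟩, ?_⟩, ?_⟩
          · simpa using (Int.fract_lt_one r).le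
          · convert hx using 1
            rw [map_add, map_zsmul, ← Int.cast_smul_eq_zsmul ℝ, Int.fract]
            push_cast
            module
          · simp only
            rw [QuotientAddGroup.eq]
            exact ⟨⌊r⌋, by simp⟩)
      refine ⟨p + Polynomial.X * p', fun t => ?_⟩
      rw [Polynomial.eval_add, Polynomial.eval_mul, Polynomial.eval_X, ← hp, ← hp', himage]
      have := ncard_sweep φ (u 0) hu (convex_dilatedZonotope v (fun i : Fin n => φ (u i.succ)) t)
        (hsweep t) t
      simp only [mem_dilatedZonotope_succ v (fun i => φ (u i))]
      exact_mod_cast this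

end Counting

section Ehrhart

variable {d n : ℕ}

/-- `castVec` as a homomorphism of additive groups. -/
def castVecHom (d : ℕ) : (Fin d → ℤ) →+ (Fin d → ℝ) where
  toFun := castVec
  map_zero' := by ext; simp [castVec]
  map_add' x y := by ext; simp [castVec]

@[simp]
theorem castVecHom_apply (x : Fin d → ℤ) : castVecHom d x = castVec x := rfl

theorem finite_castVec_mem_dilatedZonotope (v : Fin d → ℝ) (u : Fin n → Fin d → ℤ) (t : ℝ) :
    {x : Fin d → ℤ | castVec x ∈ dilatedZonotope v (fun i => castVec (u i)) t}.Finite := by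
  set b : Fin d → ℝ := fun j => |v j| + ∑ i, t * |(u i j : ℝ)| with hb
  refine (Set.finite_Icc (fun j => -⌈b j⌉) (fun j => ⌈b j⌉)).subset ?_
  rintro x ⟨l, hl, hx⟩
  have hbound (j : Fin d) : |(x j : ℝ)| ≤ b j := by
    have hj : (x j : ℝ) = v j + ∑ i, l i * (u i j : ℝ) := by
      simpa [castVec, Finset.sum_apply] using congrFun hx j
    rw [hj]
    refine (abs_add_le _ _).trans (add_le_add le_rfl ((Finset.abs_sum_le_sum_abs _ _).trans ?_))
    refine Finset.sum_le_sum fun i _ => ?_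
    rw [abs_mul, abs_of_nonneg (hl i).1]
    exact mul_le_mul_of_nonneg_right (hl i).2 (abs_nonneg _)
  constructor <;> intro j
  · have := (abs_le.1 (hbound j)).1
    have h2 := Int.le_ceil (b j)
    have : (-⌈b j⌉ : ℝ) ≤ x j := by linarith
    exact_mod_cast this
  · have := (abs_le.1 (hbound j)).2
    have h2 := Int.le_ceil (b j)
    have : (x j : ℝ) ≤ ⌈b j⌉ := by linarith
    exact_mod_cast this

theorem smul_vadd_zonotopeZ (v : Fin d → ℝ) (u : Fin n → Fin d → ℤ) {t : ℝ} (ht : 0 < t) :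
    t • (v +ᵥ zonotopeZ u) = dilatedZonotope (t • v) (fun i => castVec (u i)) t := by
  ext y
  constructor
  · rintro ⟨_, ⟨_, ⟨l, hl, rfl⟩, rfl⟩, rfl⟩
    refine ⟨fun i => t * l i, fun i => ⟨mul_nonneg ht.le (hl i).1,
      mul_le_of_le_one_right ht.le (hl i).2⟩, ?_⟩
    simp [smul_add, Finset.smul_sum, mul_smul]
  · rintro ⟨l, hl, rfl⟩
    refine ⟨_, ⟨_, ⟨fun i => l i / t, fun i => ⟨div_nonneg (hl i).1 ht.le,
      (div_le_one ht).2 (hl i).2⟩, rfl⟩, rfl⟩, ?_⟩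
    simp only [vadd_eq_add, smul_add, Finset.smul_sum, smul_smul, mul_div_cancel₀ _ ht.ne']

theorem latCount_dilatedZonotope_add_castVec (v : Fin d → ℝ) (a : Fin d → ℤ)
    (w : Fin n → Fin d → ℝ) (t : ℝ) :
    latCount (dilatedZonotope (v + castVec a) w t) = latCount (dilatedZonotope v w t) := by
  unfold latCount
  rw [← Set.ncard_image_of_injective
    {x : Fin d → ℤ | castVec x ∈ dilatedZonotope v w t} (add_left_injective a)]
  congr 1
  ext x
  constructor
  · rintro ⟨l, hl, h⟩
    refine ⟨x - a, ⟨l, hl, ?_⟩, sub_add_cancel x a⟩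
    rw [← castVecHom_apply, map_sub, castVecHom_apply, castVecHom_apply, h]
    abel
  · rintro ⟨x, ⟨l, hl, h⟩, rfl⟩
    refine ⟨l, hl, ?_⟩
    rw [← castVecHom_apply, map_add, castVecHom_apply, castVecHom_apply, h]
    abel

theorem denv_dvd_iff (c : Fin d → ℚ) (k : ℕ) :
    denv c ∣ k ↔ ∃ a : Fin d → ℤ, (k : ℝ) • ratVec c = castVec a := by
  have hcoord (i : Fin d) : (c i).den ∣ k ↔ ∃ a : ℤ, (k : ℝ) * (c i : ℝ) = a := by
    constructor
    · rintro ⟨j, rfl⟩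
      refine ⟨j * (c i).num, ?_⟩
      have : (((c i).den * j : ℕ) : ℚ) * c i = (j * (c i).num : ℤ) := by
        push_cast
        rw [mul_right_comm, Rat.den_mul_eq_num, mul_comm]
      exact_mod_cast this
    · rintro ⟨a, ha⟩
      have ha' : (k : ℚ) * c i = a := by exact_mod_cast ha
      have h1 : (k : ℤ) * (c i).num = a * (c i).den := by
        have : (k : ℚ) * ((c i).num : ℚ) = a * (c i).den := by
          rw [← ha', mul_assoc, Rat.mul_den_eq_num]
        exact_mod_cast this
      have h2 : ((c i).den : ℤ) ∣ k * (c i).num := ⟨a, by rw [h1, mul_comm]⟩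
      have hcop : IsCoprime ((c i).den : ℤ) (c i).num := by
        rw [Int.isCoprime_iff_gcd_eq_one, Int.gcd_comm]
        simpa [Int.gcd] using (c i).reduced
      exact_mod_cast hcop.dvd_of_dvd_mul_right h2
  rw [denv, Finset.lcm_dvd_iff]
  simp only [Finset.mem_univ, true_implies, hcoord]
  constructor
  · intro h
    choose a ha using h
    exact ⟨a, funext ha⟩
  · rintro ⟨a, ha⟩ i
    exact ⟨a i, congrFun ha i⟩

theorem denv_pos (c : Fin d → ℚ) : 0 < denv c := by
  refine Nat.pos_of_ne_zero fun h => ?_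
  obtain ⟨i, -, hi⟩ := Finset.lcm_eq_zero_iff.1 h
  exact (c i).den_nz hi

theorem ehr_zonotopeZ_of_modEq (u : Fin n → Fin d → ℤ) (c : Fin d → ℚ) {t k : ℕ} (ht : 0 < t)
    (hk : k ≤ t) (h : k ≡ t [MOD denv c]) :
    ehr (zonotopeZ u) c t =
      latCount (dilatedZonotope ((k : ℝ) • ratVec c) (fun i => castVec (u i)) t) := by
  obtain ⟨a, ha⟩ := (denv_dvd_iff c (t - k)).1 ((Nat.modEq_iff_dvd' hk).1 h)
  have hsplit : (t : ℝ) • ratVec c = (k : ℝ) • ratVec c + castVec a := by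
    rw [← ha, ← add_smul, Nat.cast_sub hk, add_sub_cancel]
  rw [ehr, smul_vadd_zonotopeZ _ _ (by exact_mod_cast ht), hsplit,
    latCount_dilatedZonotope_add_castVec]

theorem latCount_dilatedZonotope_zero_ne_zero_iff (v : Fin d → ℝ) (w : Fin n → Fin d → ℝ) :
    latCount (dilatedZonotope v w 0) ≠ 0 ↔ ∃ a : Fin d → ℤ, v = castVec a := by
  have hset : dilatedZonotope v w 0 = {v} := by
    ext y
    constructor
    · rintro ⟨l, hl, rfl⟩
      have : l = 0 := funext fun i => le_antisymm (hl i).2 (hl i).1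
      simp [this]
    · rintro rfl
      exact ⟨0, by simp, by simp⟩
  have hinj : Function.Injective (castVec (d := d)) := fun x y h =>
    funext fun i => Int.cast_injective (α := ℝ) (congrFun h i)
  have hsub : {x : Fin d → ℤ | castVec x = v}.Subsingleton := fun x hx y hy =>
    hinj (hx.trans hy.symm)
  rw [latCount, hset]
  simp only [Set.mem_singleton_iff]
  rw [Ne, Set.ncard_eq_zero hsub.finite, ← Ne, ← Set.nonempty_iff_ne_empty]
  exact exists_congr fun a => eq_comm

end Ehrhart

/-- For a lattice zonotope `P = Z(u₁,…,uₙ)` and `c ∈ ℚ^d`, the minimal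
period of the Ehrhart quasi-polynomial `L_{c+P}` is exactly `den(c)`. -/
theorem minimal_period_of_almost_integral_zonotope
    (d n : ℕ) (u : Fin n → Fin d → ℤ) (c : Fin d → ℚ) :
    IsMinimalPeriodOf (denv c) (ehr (zonotopeZ u) c) := by
  have hpoly (k : ℕ) : ∃ p : Polynomial ℚ, ∀ t : ℕ,
      (latCount (dilatedZonotope ((k : ℝ) • ratVec c) (fun i => castVec (u i)) t) : ℚ) =
        p.eval (t : ℚ) :=
    exists_polynomial_ncard_dilatedZonotope n _ _ (castVecHom d) _ u
      fun t => finite_castVec_mem_dilatedZonotope _ _ _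
  choose p hp using hpoly
  have hD := denv_pos c
  refine ⟨⟨hD, p, fun t ht => ?_⟩, fun ρ ⟨hρ, f, hf⟩ => ?_⟩
  · rw [ehr_zonotopeZ_of_modEq u c ht (Nat.mod_le t _) (Nat.mod_modEq t _), hp]
  · have heq (k : ℕ) (hk : ρ ∣ k) : p k = f 0 := by
      refine Polynomial.eq_of_infinite_eval_eq _ _ (Set.Infinite.mono (s := Set.range
        fun j : ℕ => ((k + (j + 1) * (ρ * denv c) : ℕ) : ℚ)) ?_ ?_)
      · rintro _ ⟨j, rfl⟩
        have ht : 0 < k + (j + 1) * (ρ * denv c) := by positivity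
        have hmod : k ≡ k + (j + 1) * (ρ * denv c) [MOD denv c] := by
          rw [← mul_assoc]
          simp [Nat.ModEq]
        have hzero : (k + (j + 1) * (ρ * denv c)) % ρ = 0 :=
          Nat.mod_eq_zero_of_dvd (hk.add ((dvd_mul_right _ _).mul_left _))
        have h := hf _ ht
        rw [hzero, ehr_zonotopeZ_of_modEq u c ht (Nat.le_add_right _ _) hmod, hp] at h
        exact h
      · refine Set.infinite_range_of_injective fun i j h => ?_
        have h' := Nat.add_left_cancel (Nat.cast_injective (R := ℚ) h)
        exact Nat.succ_injective (Nat.eq_of_mul_eq_mul_right (by positivity) h')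
    have hzero (k : ℕ) : (p k).eval 0 ≠ 0 ↔ denv c ∣ k := by
      rw [denv_dvd_iff, ← latCount_dilatedZonotope_zero_ne_zero_iff _ (fun i => castVec (u i))]
      have := hp k 0
      rw [Nat.cast_zero, Nat.cast_zero] at this
      rw [← this, Nat.cast_ne_zero]
    refine Nat.le_of_dvd hρ ((hzero ρ).1 ?_)
    rw [heq ρ dvd_rfl, ← heq 0 (dvd_zero ρ)]
    exact (hzero 0).2 (dvd_zero _)
end
end

section
/- Let n > 7 be an integer and let P_n ⊂ ℝ³ be the lattice polytope P_n = conv{0, ne₁, ne₂, n(e₁+e₂), e₃, ne₂+e₃, (1−n)e₃}, where e₁, e₂, e₃ is the standard basis of ℝ³. Then #(P_n ∩ ℤ³) = (2n³ + 3n² + 19n + 12)/6. -/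
open Pointwise MeasureTheory
open scoped RealInnerProductSpace

noncomputable section

/-- Linear inequalities valid on the convex hull defining `P_n`, with `n = m + 1`. -/
lemma convexHull_vertices_subset (m : ℕ) :
    convexHull ℝ
      ({![0, 0, 0], ![((m + 1 : ℕ) : ℝ), 0, 0], ![0, ((m + 1 : ℕ) : ℝ), 0],
        ![((m + 1 : ℕ) : ℝ), ((m + 1 : ℕ) : ℝ), 0], ![0, 0, 1], ![0, ((m + 1 : ℕ) : ℝ), 1],
        ![0, 0, 1 - ((m + 1 : ℕ) : ℝ)]} : Set (Fin 3 → ℝ)) ⊆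
    {v | 0 ≤ v 0 ∧ 0 ≤ v 1 ∧ v 2 ≤ 1 ∧ v 1 ≤ m + 1 ∧ v 0 ≤ (m + 1) * (1 - v 2) ∧
      m * v 0 ≤ (m + 1) * (m + v 2) ∧ m * v 1 ≤ (m + 1) * (m + v 2)} := by
  have hm : (0 : ℝ) ≤ m := m.cast_nonneg
  apply convexHull_min
  · intro v hv
    simp only [Set.mem_insert_iff, Set.mem_singleton_iff] at hv
    rcases hv with rfl | rfl | rfl | rfl | rfl | rfl | rfl <;>
      simp <;> (try constructorm* _ ∧ _) <;> nlinarith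
  · intro u hu v hv a b ha hb hab
    obtain ⟨h1, h2, h3, h4, h5, h6, h7⟩ := hu
    obtain ⟨k1, k2, k3, k4, k5, k6, k7⟩ := hv
    obtain rfl : b = 1 - a := by linarith
    simp only [Set.mem_ofPred_eq, Pi.add_apply, Pi.smul_apply, smul_eq_mul]
    refine ⟨?_, ?_, ?_, ?_, ?_, ?_, ?_⟩
    · positivity
    · positivity
    · linear_combination a * h3 + (1 - a) * k3
    · linear_combination a * h4 + (1 - a) * k4
    · linear_combination a * h5 + (1 - a) * k5
    · linear_combination a * h6 + (1 - a) * k6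
    · linear_combination a * h7 + (1 - a) * k7

lemma Convex.combo_four_mem {E : Type*} [AddCommGroup E] [Module ℝ E] {s : Set E}
    (hs : Convex ℝ s) {p q r t : E} (hp : p ∈ s) (hq : q ∈ s) (hr : r ∈ s) (ht : t ∈ s)
    {a b c d : ℝ} (ha : 0 ≤ a) (hb : 0 ≤ b) (hc : 0 ≤ c) (hd : 0 ≤ d)
    (h : a + b + c + d = 1) : a • p + b • q + c • r + d • t ∈ s := by
  have := hs.sum_mem (t := Finset.univ) (w := ![a, b, c, d]) (z := ![p, q, r, t])
    (by intro i _; fin_cases i <;> simpa)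
    (by simpa [Fin.sum_univ_four] using h)
    (by intro i _; fin_cases i <;> simpa)
  simpa [Fin.sum_univ_four] using this

/-- A point of the pyramid over the square `[0, n]²` with apex `(0, 0, 1 - n)` lies in `P_n`. -/
lemma mem_convexHull_of_nonpos (m : ℕ) (hm : 0 < m) (x y z : ℝ) (hx : 0 ≤ x) (hy : 0 ≤ y)
    (hz : z ≤ 0) (hxz : m * x ≤ (m + 1) * (m + z)) (hyz : m * y ≤ (m + 1) * (m + z)) :
    ![x, y, z] ∈ convexHull ℝ
      ({![0, 0, 0], ![((m + 1 : ℕ) : ℝ), 0, 0], ![0, ((m + 1 : ℕ) : ℝ), 0],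
        ![((m + 1 : ℕ) : ℝ), ((m + 1 : ℕ) : ℝ), 0], ![0, 0, 1], ![0, ((m + 1 : ℕ) : ℝ), 1],
        ![0, 0, 1 - ((m + 1 : ℕ) : ℝ)]} : Set (Fin 3 → ℝ)) := by
  set V := ({![0, 0, 0], ![((m + 1 : ℕ) : ℝ), 0, 0], ![0, ((m + 1 : ℕ) : ℝ), 0],
        ![((m + 1 : ℕ) : ℝ), ((m + 1 : ℕ) : ℝ), 0], ![0, 0, 1], ![0, ((m + 1 : ℕ) : ℝ), 1],
        ![0, 0, 1 - ((m + 1 : ℕ) : ℝ)]} : Set (Fin 3 → ℝ)) with hV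
  have hm' : (0 : ℝ) < m := by exact_mod_cast hm
  have weight_nonneg : ∀ w : ℝ, m * w ≤ (m + 1) * (m + z) →
      0 ≤ (m + z) / m - w / (m + 1) := by
    intro w hw
    rw [sub_nonneg, div_le_div_iff₀ (by positivity) hm']
    linarith
  have weight_apex : 0 ≤ -z / m := div_nonneg (by linarith) hm'.le
  have h0 : ![0, 0, 0] ∈ convexHull ℝ V := subset_convexHull ℝ V (by simp [hV])
  have hd : ![((m + 1 : ℕ) : ℝ), ((m + 1 : ℕ) : ℝ), 0] ∈ convexHull ℝ V :=
    subset_convexHull ℝ V (by simp [hV])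
  have ha : ![0, 0, 1 - ((m + 1 : ℕ) : ℝ)] ∈ convexHull ℝ V :=
    subset_convexHull ℝ V (by simp [hV])
  rcases le_total y x with h | h
  · have hq : ![((m + 1 : ℕ) : ℝ), 0, 0] ∈ convexHull ℝ V :=
      subset_convexHull ℝ V (by simp [hV])
    convert (convex_convexHull ℝ V).combo_four_mem h0 hq hd ha (weight_nonneg x hxz)
      (div_nonneg (sub_nonneg.2 h) (by positivity : (0 : ℝ) ≤ m + 1))
      (div_nonneg hy (by positivity : (0 : ℝ) ≤ m + 1)) weight_apex
      (by field_simp; ring) using 1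
    ext i
    fin_cases i <;> simp <;> field_simp <;> ring
  · have hq : ![0, ((m + 1 : ℕ) : ℝ), 0] ∈ convexHull ℝ V :=
      subset_convexHull ℝ V (by simp [hV])
    convert (convex_convexHull ℝ V).combo_four_mem h0 hq hd ha (weight_nonneg y hyz)
      (div_nonneg (sub_nonneg.2 h) (by positivity : (0 : ℝ) ≤ m + 1))
      (div_nonneg hx (by positivity : (0 : ℝ) ≤ m + 1)) weight_apex
      (by field_simp; ring) using 1
    ext i
    fin_cases i <;> simp <;> field_simp <;> ring

lemma mem_convexHull_top (m : ℕ) (y : ℝ) (hy : 0 ≤ y) (hym : y ≤ m + 1) :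
    ![0, y, 1] ∈ convexHull ℝ
      ({![0, 0, 0], ![((m + 1 : ℕ) : ℝ), 0, 0], ![0, ((m + 1 : ℕ) : ℝ), 0],
        ![((m + 1 : ℕ) : ℝ), ((m + 1 : ℕ) : ℝ), 0], ![0, 0, 1], ![0, ((m + 1 : ℕ) : ℝ), 1],
        ![0, 0, 1 - ((m + 1 : ℕ) : ℝ)]} : Set (Fin 3 → ℝ)) := by
  set V := ({![0, 0, 0], ![((m + 1 : ℕ) : ℝ), 0, 0], ![0, ((m + 1 : ℕ) : ℝ), 0],
        ![((m + 1 : ℕ) : ℝ), ((m + 1 : ℕ) : ℝ), 0], ![0, 0, 1], ![0, ((m + 1 : ℕ) : ℝ), 1],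
        ![0, 0, 1 - ((m + 1 : ℕ) : ℝ)]} : Set (Fin 3 → ℝ)) with hV
  have hp : ![0, 0, 1] ∈ convexHull ℝ V := subset_convexHull ℝ V (by simp [hV])
  have hq : ![0, ((m + 1 : ℕ) : ℝ), 1] ∈ convexHull ℝ V :=
    subset_convexHull ℝ V (by simp [hV])
  have hpos : (0 : ℝ) < m + 1 := by positivity
  convert convex_convexHull ℝ V hp hq
    (sub_nonneg.2 ((div_le_one hpos).2 hym)) (div_nonneg hy hpos.le) (by ring) using 1
  ext i
  fin_cases i <;> simp <;> field_simp

/-- The lattice points of `P_{m+1}` with negative last coordinate. -/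
def lowerPoints (m : ℕ) : Finset (Fin 3 → ℤ) :=
  ((Finset.range m).sigma fun j => Finset.range (j + 1) ×ˢ Finset.range (j + 1)).image
    fun p => ![(p.2.1 : ℤ), (p.2.2 : ℤ), (p.1 : ℤ) - m]

/-- The lattice points of `P_{m+1}` with last coordinate `0`. -/
def middlePoints (m : ℕ) : Finset (Fin 3 → ℤ) :=
  (Finset.range (m + 2) ×ˢ Finset.range (m + 2)).image fun p => ![(p.1 : ℤ), (p.2 : ℤ), 0]

/-- The lattice points of `P_{m+1}` with last coordinate `1`. -/
def upperPoints (m : ℕ) : Finset (Fin 3 → ℤ) :=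
  (Finset.range (m + 2)).image fun b : ℕ => ![0, (b : ℤ), 1]

lemma mem_lowerPoints (m : ℕ) (v : Fin 3 → ℤ) : v ∈ lowerPoints m ↔
    0 ≤ v 0 ∧ 0 ≤ v 1 ∧ v 2 < 0 ∧ v 0 ≤ m + v 2 ∧ v 1 ≤ m + v 2 := by
  simp only [lowerPoints, Finset.mem_image, Finset.mem_sigma, Finset.mem_product,
    Finset.mem_range]
  constructor
  · rintro ⟨⟨j, a, b⟩, h, rfl⟩
    simp at h ⊢
    omega
  · rintro ⟨h0, h1, h2, h3, h4⟩
    refine ⟨⟨(m + v 2).toNat, (v 0).toNat, (v 1).toNat⟩, by simp; omega, ?_⟩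
    ext i
    fin_cases i <;> simp <;> omega

lemma mem_middlePoints (m : ℕ) (v : Fin 3 → ℤ) : v ∈ middlePoints m ↔
    0 ≤ v 0 ∧ 0 ≤ v 1 ∧ v 2 = 0 ∧ v 0 ≤ m + 1 ∧ v 1 ≤ m + 1 := by
  simp only [middlePoints, Finset.mem_image, Finset.mem_product, Finset.mem_range]
  constructor
  · rintro ⟨⟨a, b⟩, h, rfl⟩
    simp at h ⊢
    omega
  · rintro ⟨h0, h1, h2, h3, h4⟩
    refine ⟨⟨(v 0).toNat, (v 1).toNat⟩, by simp; omega, ?_⟩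
    ext i
    fin_cases i <;> simp <;> omega

lemma mem_upperPoints (m : ℕ) (v : Fin 3 → ℤ) : v ∈ upperPoints m ↔
    v 0 = 0 ∧ 0 ≤ v 1 ∧ v 2 = 1 ∧ v 1 ≤ m + 1 := by
  simp only [upperPoints, Finset.mem_image, Finset.mem_range]
  constructor
  · rintro ⟨b, h, rfl⟩
    simp
    omega
  · rintro ⟨h0, h1, h2, h3⟩
    refine ⟨(v 1).toNat, by omega, ?_⟩
    ext i
    fin_cases i <;> simp <;> omega

lemma card_lowerPoints (m : ℕ) :
    (lowerPoints m).card = ∑ j ∈ Finset.range m, (j + 1) * (j + 1) := by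
  rw [lowerPoints, Finset.card_image_of_injective]
  · simp
  · rintro ⟨j, a, b⟩ ⟨j', a', b'⟩ h
    have h0 := congrFun h 0
    have h1 := congrFun h 1
    have h2 := congrFun h 2
    simp at h0 h1 h2
    subst h0 h1 h2
    rfl

lemma card_middlePoints (m : ℕ) : (middlePoints m).card = (m + 2) * (m + 2) := by
  rw [middlePoints, Finset.card_image_of_injective]
  · simp
  · rintro ⟨a, b⟩ ⟨a', b'⟩ h
    have h0 := congrFun h 0
    have h1 := congrFun h 1
    simp at h0 h1
    simp [h0, h1]

lemma card_upperPoints (m : ℕ) : (upperPoints m).card = m + 2 := by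
  rw [upperPoints, Finset.card_image_of_injective]
  · simp
  · intro a b h
    simpa using congrFun h 1

lemma sum_range_succ_mul_self (m : ℕ) :
    ((∑ j ∈ Finset.range m, (j + 1) * (j + 1) : ℕ) : ℚ) = m * (m + 1) * (2 * m + 1) / 6 := by
  induction m with
  | zero => simp
  | succ k ih =>
    rw [Finset.sum_range_succ, Nat.cast_add, ih]
    push_cast
    ring

lemma castVec_mem_convexHull_iff (m : ℕ) (hm : 0 < m) (v : Fin 3 → ℤ) :
    castVec v ∈ convexHull ℝ
      ({![0, 0, 0], ![((m + 1 : ℕ) : ℝ), 0, 0], ![0, ((m + 1 : ℕ) : ℝ), 0],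
        ![((m + 1 : ℕ) : ℝ), ((m + 1 : ℕ) : ℝ), 0], ![0, 0, 1], ![0, ((m + 1 : ℕ) : ℝ), 1],
        ![0, 0, 1 - ((m + 1 : ℕ) : ℝ)]} : Set (Fin 3 → ℝ)) ↔
    v ∈ lowerPoints m ∪ middlePoints m ∪ upperPoints m := by
  have hv : castVec v = ![(v 0 : ℝ), (v 1 : ℝ), (v 2 : ℝ)] := by
    ext i
    fin_cases i <;> rfl
  simp only [Finset.mem_union, mem_lowerPoints, mem_middlePoints, mem_upperPoints]
  have hmZ : (0 : ℤ) < m := by exact_mod_cast hm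
  constructor
  · intro h
    obtain ⟨h0, h1, h2, h3, h4, h5, h6⟩ := convexHull_vertices_subset m h
    simp only [castVec] at h0 h1 h2 h3 h4 h5 h6
    norm_cast at h0 h1 h2 h3
    have h4' : v 0 ≤ (m + 1) * (1 - v 2) := by exact_mod_cast h4
    have h5' : m * v 0 ≤ (m + 1) * (m + v 2) := by exact_mod_cast h5
    have h6' : m * v 1 ≤ (m + 1) * (m + v 2) := by exact_mod_cast h6
    push_cast at h3
    rcases lt_trichotomy (v 2) 0 with hz | hz | hz
    · have slice_bound : ∀ w : ℤ, m * w ≤ (m + 1) * (m + v 2) → w ≤ m + v 2 := by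
        intro w hw
        by_contra! hlt
        nlinarith
      exact Or.inl (Or.inl ⟨h0, h1, hz, slice_bound _ h5', slice_bound _ h6'⟩)
    · rw [hz] at h4'
      exact Or.inl (Or.inr ⟨h0, h1, hz, by linarith, h3⟩)
    · have hz1 : v 2 = 1 := by omega
      rw [hz1] at h4'
      exact Or.inr ⟨by linarith, h1, hz1, h3⟩
  · rw [hv]
    rintro ((⟨h0, h1, h2, h3, h4⟩ | ⟨h0, h1, h2, h3, h4⟩) | ⟨h0, h1, h2, h3⟩)
    · have slice_bound : ∀ w : ℤ, 0 ≤ w → w ≤ m + v 2 →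
          (m : ℝ) * w ≤ (m + 1) * (m + v 2) := by
        intro w h hw
        have : m * w ≤ (m + 1) * (m + v 2) := by nlinarith
        exact_mod_cast this
      exact mem_convexHull_of_nonpos m hm _ _ _ (by exact_mod_cast h0) (by exact_mod_cast h1)
        (by exact_mod_cast h2.le) (slice_bound _ h0 h3) (slice_bound _ h1 h4)
    · have slice_bound : ∀ w : ℤ, w ≤ m + 1 →
          (m : ℝ) * w ≤ (m + 1) * (m + v 2) := by
        intro w hw
        have : m * w ≤ (m + 1) * (m + v 2) := by rw [h2]; nlinarith
        exact_mod_cast this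
      exact mem_convexHull_of_nonpos m hm _ _ _ (by exact_mod_cast h0) (by exact_mod_cast h1)
        (by exact_mod_cast h2.le) (slice_bound _ h3) (slice_bound _ h4)
    · rw [h0, h2]
      simpa using mem_convexHull_top m (v 1) (by exact_mod_cast h1) (by exact_mod_cast h3)

/-- For `n > 7`, the lattice polytope
`P_n = conv{0, ne₁, ne₂, n(e₁+e₂), e₃, ne₂+e₃, (1−n)e₃} ⊂ ℝ³` satisfies
`#(P_n ∩ ℤ³) = (2n³ + 3n² + 19n + 12)/6`. -/
theorem latCount_P_n (n : ℕ) (hn : 7 < n) (P : Set (Fin 3 → ℝ))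
    (hPn : P = convexHull ℝ
      ({![0, 0, 0], ![(n : ℝ), 0, 0], ![0, (n : ℝ), 0], ![(n : ℝ), (n : ℝ), 0],
        ![0, 0, 1], ![0, (n : ℝ), 1], ![0, 0, 1 - (n : ℝ)]} : Set (Fin 3 → ℝ))) :
    (latCount P : ℚ) = (2 * (n : ℚ) ^ 3 + 3 * (n : ℚ) ^ 2 + 19 * (n : ℚ) + 12) / 6 := by
  obtain ⟨m, rfl⟩ : ∃ m, n = m + 1 := ⟨n - 1, by omega⟩
  have hset : {v : Fin 3 → ℤ | castVec v ∈ P} =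
      ↑(lowerPoints m ∪ middlePoints m ∪ upperPoints m) := by
    ext v
    rw [Set.mem_ofPred_eq, hPn, castVec_mem_convexHull_iff m (by omega) v, Finset.mem_coe]
  have hd₁ : Disjoint (lowerPoints m) (middlePoints m) := by
    rw [Finset.disjoint_left]
    intro v hv hv'
    rw [mem_lowerPoints] at hv
    rw [mem_middlePoints] at hv'
    omega
  have hd₂ : Disjoint (lowerPoints m ∪ middlePoints m) (upperPoints m) := by
    rw [Finset.disjoint_left]
    intro v hv hv'
    rw [Finset.mem_union, mem_lowerPoints, mem_middlePoints] at hv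
    rw [mem_upperPoints] at hv'
    omega
  rw [latCount, hset, Set.ncard_coe_finset, Finset.card_union_of_disjoint hd₂,
    Finset.card_union_of_disjoint hd₁, card_lowerPoints, card_middlePoints, card_upperPoints,
    Nat.cast_add, Nat.cast_add, sum_range_succ_mul_self]
  push_cast
  ring
end
end
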